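/- arXiv:2108.10596 — 13 statements merged into one kernel-verified Lean document; each statement's English description precedes it below -/
import Mathlib

section
/- Let j ≥ 0 be an integer and let g_0, g_1, …, g_j be real numbers with g_j > g_{j−1} > … > g_0 > 0. Then for any real numbers v_0, v_1, …, v_{j+1}, one has v_{j+1} · Σ_{s=0}^{j} (v_{s+1} − v_s) g_s ≥ (1/2) Σ_{s=0}^{j} (v_{s+1}² − v_s²) g_s + (1/(2 g_j)) ( Σ_{s=0}^{j} (v_{s+1} − v_s) g_s )². -/
/-- Lemma 1, inequality (5) of the paper.
For weights `g 0 < g 1 < … < g j`, all positive, and any reals `v 0, …, v (j+1)`: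
`v_{j+1} · Σ (v_{s+1} − v_s) g_s ≥ (1/2) Σ (v_{s+1}² − v_s²) g_s + (1/(2 g_j)) (Σ (v_{s+1} − v_s) g_s)²`. -/
theorem statement0 (j : ℕ) (g v : ℕ → ℝ)
    (hg_pos : 0 < g 0)
    (hg_mono : ∀ s, s < j → g s < g (s + 1)) :
    v (j + 1) * (∑ s ∈ Finset.range (j + 1), (v (s + 1) - v s) * g s) ≥
      (1 / 2) * (∑ s ∈ Finset.range (j + 1), ((v (s + 1)) ^ 2 - (v s) ^ 2) * g s) +
        (1 / (2 * g j)) * (∑ s ∈ Finset.range (j + 1), (v (s + 1) - v s) * g s) ^ 2 := by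
  suffices h : 0 < g j ∧ (1 / 2) * (∑ s ∈ Finset.range (j + 1), ((v (s + 1)) ^ 2 - (v s) ^ 2) * g s) +
      (1 / (2 * g j)) * (∑ s ∈ Finset.range (j + 1), (v (s + 1) - v s) * g s) ^ 2 ≤
      v (j + 1) * (∑ s ∈ Finset.range (j + 1), (v (s + 1) - v s) * g s) from h.2
  induction j with
  | zero =>
    refine ⟨hg_pos, le_of_eq ?_⟩
    simp only [zero_add, Finset.sum_range_one]
    field_simp
    ring
  | succ j ih =>
    obtain ⟨hpos, hle⟩ := ih fun s hs => hg_mono s (by omega)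
    have hlt : g j < g (j + 1) := hg_mono j (by omega)
    have hpos' : 0 < g (j + 1) := hpos.trans hlt
    refine ⟨hpos', ?_⟩
    rw [Finset.sum_range_succ _ (j + 1), Finset.sum_range_succ _ (j + 1)]
    generalize ∑ s ∈ Finset.range (j + 1), (v (s + 1) - v s) * g s = D at hle ⊢
    generalize ∑ s ∈ Finset.range (j + 1), ((v (s + 1)) ^ 2 - (v s) ^ 2) * g s = Q at hle ⊢
    have hD : 1 / (2 * g (j + 1)) * D ^ 2 ≤ 1 / (2 * g j) * D ^ 2 := by gcongr
    have expand : ∀ d : ℝ, 1 / (2 * g (j + 1)) * (D + d * g (j + 1)) ^ 2 =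
        1 / (2 * g (j + 1)) * D ^ 2 + d * D + d ^ 2 * g (j + 1) / 2 := by
      intro d
      field_simp
      ring
    rw [expand]
    linarith
end

section
/- Let j ≥ 0 be an integer and let g_0, g_1, …, g_j be real numbers with g_j > g_{j−1} > … > g_0 > 0, and set g_{−1} = 0 when j = 0. Then for any real numbers v_0, v_1, …, v_{j+1}, one has v_j · Σ_{s=0}^{j} (v_{s+1} − v_s) g_s ≥ (1/2) Σ_{s=0}^{j} (v_{s+1}² − v_s²) g_s − (1/(2 (g_j − g_{j−1}))) ( Σ_{s=0}^{j} (v_{s+1} − v_s) g_s )². -/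
theorem weights_pos {j : ℕ} {g : ℕ → ℝ} (hg_pos : 0 < g 0)
    (hg_mono : ∀ s, s < j → g s < g (s + 1)) {n : ℕ} (hn : n ≤ j) : 0 < g n := by
  induction n with
  | zero => exact hg_pos
  | succ n ih => exact (ih (by omega)).trans (hg_mono n (by omega))

/-- A Cauchy–Schwarz type bound for the fractional difference operator with increasing weights,
expanded around the last value `v (n + 1)`. -/
theorem sq_sum_sub_mul_le {j : ℕ} {g : ℕ → ℝ} (v : ℕ → ℝ) (hg_pos : 0 < g 0)
    (hg_mono : ∀ s, s < j → g s < g (s + 1)) {n : ℕ} (hn : n ≤ j) :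
    (∑ s ∈ Finset.range (n + 1), (v (s + 1) - v s) * g s) ^ 2 ≤
      g n * (2 * v (n + 1) * (∑ s ∈ Finset.range (n + 1), (v (s + 1) - v s) * g s) -
        ∑ s ∈ Finset.range (n + 1), ((v (s + 1)) ^ 2 - (v s) ^ 2) * g s) := by
  induction n with
  | zero =>
    simp only [zero_add, Finset.sum_range_one]
    exact le_of_eq (by ring)
  | succ n ih =>
    have hS := ih (by omega)
    have hpos : 0 < g n := weights_pos hg_pos hg_mono (by omega)
    have hlt := hg_mono n (by omega)
    rw [Finset.sum_range_succ _ (n + 1), Finset.sum_range_succ _ (n + 1)]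
    set S := ∑ s ∈ Finset.range (n + 1), (v (s + 1) - v s) * g s
    set Q := ∑ s ∈ Finset.range (n + 1), ((v (s + 1)) ^ 2 - (v s) ^ 2) * g s
    have hR : 0 ≤ 2 * v (n + 1) * S - Q :=
      nonneg_of_mul_nonneg_right ((sq_nonneg S).trans hS) hpos
    have hmul := mul_le_mul_of_nonneg_right hlt.le hR
    linear_combination hS + hmul

/-- Lemma 1, inequality (6) of the paper.
For weights `g 0 < g 1 < … < g j`, all positive (with `g_{-1} = 0` when `j = 0`),
and any reals `v 0, …, v (j+1)`:
`v_j · Σ (v_{s+1} − v_s) g_s ≥ (1/2) Σ (v_{s+1}² − v_s²) g_s − (1/(2 (g_j − g_{j−1}))) (Σ (v_{s+1} − v_s) g_s)²`. -/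
theorem statement1 (j : ℕ) (g v : ℕ → ℝ)
    (hg_pos : 0 < g 0)
    (hg_mono : ∀ s, s < j → g s < g (s + 1)) :
    v j * (∑ s ∈ Finset.range (j + 1), (v (s + 1) - v s) * g s) ≥
      (1 / 2) * (∑ s ∈ Finset.range (j + 1), ((v (s + 1)) ^ 2 - (v s) ^ 2) * g s) -
        (1 / (2 * (g j - (if j = 0 then 0 else g (j - 1))))) *
          (∑ s ∈ Finset.range (j + 1), (v (s + 1) - v s) * g s) ^ 2 := by
  rcases j with _ | n
  · simp only [zero_add, Finset.sum_range_one, if_true, sub_zero]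
    have hne : g 0 ≠ 0 := hg_pos.ne'
    refine le_of_eq ?_
    field_simp
    ring
  · have hS := sq_sum_sub_mul_le v hg_pos hg_mono n.le_succ
    have hpos : 0 < g n := weights_pos hg_pos hg_mono n.le_succ
    have hlt := hg_mono n n.lt_succ_self
    rw [Finset.sum_range_succ _ (n + 1), Finset.sum_range_succ _ (n + 1), if_neg n.succ_ne_zero,
      Nat.add_sub_cancel]
    set S := ∑ s ∈ Finset.range (n + 1), (v (s + 1) - v s) * g s
    set Q := ∑ s ∈ Finset.range (n + 1), ((v (s + 1)) ^ 2 - (v s) ^ 2) * g s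
    set b := v (n + 1 + 1) - v (n + 1) with hb
    have hd : 0 < g (n + 1) - g n := sub_pos.mpr hlt
    have hR : S ^ 2 / g n ≤ 2 * v (n + 1) * S - Q := by
      rw [div_le_iff₀ hpos]
      linarith
    have hsq : (S + b * g (n + 1)) ^ 2 / (g (n + 1) - g n) + S ^ 2 / g n - b ^ 2 * g (n + 1) =
        g (n + 1) * (S + b * g n) ^ 2 / (g n * (g (n + 1) - g n)) := by
      field_simp
      ring
    have hnonneg : 0 ≤ g (n + 1) * (S + b * g n) ^ 2 / (g n * (g (n + 1) - g n)) := by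
      have := hpos.trans hlt
      positivity
    have hhalf : 1 / (2 * (g (n + 1) - g n)) * (S + b * g (n + 1)) ^ 2 =
        (S + b * g (n + 1)) ^ 2 / (g (n + 1) - g n) / 2 := by
      field_simp
    have hv : v (n + 1 + 1) = v (n + 1) + b := by rw [hb]; ring
    rw [hhalf, hv]
    linear_combination (1 / 2) * hR + (1 / 2) * hnonneg - (1 / 2) * hsq
end

section
/- Let j ≥ 0 be an integer, let g_0, g_1, …, g_j be real numbers with g_j > g_{j−1} > … > g_0 > 0 (with g_{−1} = 0 when j = 0), and let σ be a real number with g_j/(2 g_j − g_{j−1}) ≤ σ ≤ 1. Then for any real numbers v_0, v_1, …, v_{j+1}, one has (σ v_{j+1} + (1 − σ) v_j) · Σ_{s=0}^{j} (v_{s+1} − v_s) g_s ≥ (1/2) Σ_{s=0}^{j} (v_{s+1}² − v_s²) g_s. -/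
/-- Lower bound for the endpoint value times a positively weighted difference sum. -/
theorem half_sum_sq_sub_add_le_right_mul (j : ℕ) (g v : ℕ → ℝ)
    (hg_pos : ∀ s, s ≤ j → 0 < g s) (hg_mono : ∀ s, s < j → g s ≤ g (s + 1)) :
    (1 / 2) * (∑ s ∈ Finset.range (j + 1), ((v (s + 1)) ^ 2 - (v s) ^ 2) * g s) +
        (∑ s ∈ Finset.range (j + 1), (v (s + 1) - v s) * g s) ^ 2 / (2 * g j) ≤
      v (j + 1) * (∑ s ∈ Finset.range (j + 1), (v (s + 1) - v s) * g s) := by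
  induction j with
  | zero =>
    have h0 := hg_pos 0 le_rfl
    simp only [zero_add, Finset.sum_range_one]
    apply le_of_eq
    field_simp
    ring
  | succ k ih =>
    have hk := hg_pos k (by omega)
    have hk' := hg_pos (k + 1) le_rfl
    have hle := hg_mono k (by omega)
    have h := ih (fun s hs => hg_pos s (by omega)) (fun s hs => hg_mono s (by omega))
    rw [Finset.sum_range_succ _ (k + 1), Finset.sum_range_succ _ (k + 1)]
    set S := ∑ s ∈ Finset.range (k + 1), (v (s + 1) - v s) * g s
    have hS : S ^ 2 / (2 * g (k + 1)) ≤ S ^ 2 / (2 * g k) := by gcongr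
    have e : (S + (v (k + 1 + 1) - v (k + 1)) * g (k + 1)) ^ 2 / (2 * g (k + 1)) =
        S ^ 2 / (2 * g (k + 1)) + S * (v (k + 1 + 1) - v (k + 1)) +
          (v (k + 1 + 1) - v (k + 1)) ^ 2 * g (k + 1) / 2 := by
      field_simp
      ring
    rw [e]
    linarith

/-- Lower bound for the penultimate value times a positively weighted difference sum. -/
theorem half_sum_sq_sub_sub_le_left_mul (j : ℕ) (g v : ℕ → ℝ)
    (hg_pos : ∀ s, s ≤ j → 0 < g s) (hg_mono : ∀ s, s < j → g s < g (s + 1)) :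
    (1 / 2) * (∑ s ∈ Finset.range (j + 1), ((v (s + 1)) ^ 2 - (v s) ^ 2) * g s) -
        (∑ s ∈ Finset.range (j + 1), (v (s + 1) - v s) * g s) ^ 2 /
          (2 * (g j - (if j = 0 then 0 else g (j - 1)))) ≤
      v j * (∑ s ∈ Finset.range (j + 1), (v (s + 1) - v s) * g s) := by
  cases j with
  | zero =>
    have h0 := hg_pos 0 le_rfl
    simp only [zero_add, Finset.sum_range_one, if_true, sub_zero]
    apply le_of_eq
    field_simp
    ring
  | succ k =>
    have hk := hg_pos k (by omega)
    have hk' := hg_pos (k + 1) le_rfl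
    have hlt := sub_pos.2 (hg_mono k (by omega))
    have h := half_sum_sq_sub_add_le_right_mul k g v (fun s hs => hg_pos s (by omega))
      (fun s hs => (hg_mono s (by omega)).le)
    rw [Finset.sum_range_succ _ (k + 1), Finset.sum_range_succ _ (k + 1)]
    simp only [Nat.add_eq_zero_iff, one_ne_zero, and_false, if_false, Nat.add_sub_cancel]
    set S := ∑ s ∈ Finset.range (k + 1), (v (s + 1) - v s) * g s
    set d := v (k + 1 + 1) - v (k + 1) with hd
    have hv : v (k + 1 + 1) = v (k + 1) + d := by rw [hd]; ring
    have e : S ^ 2 / (2 * g k) - d ^ 2 * g (k + 1) / 2 +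
        (S + d * g (k + 1)) ^ 2 / (2 * (g (k + 1) - g k)) =
        g (k + 1) * (S + d * g k) ^ 2 / (2 * g k * (g (k + 1) - g k)) := by
      have := hlt.ne'
      field_simp
      ring
    have hnonneg : 0 ≤ g (k + 1) * (S + d * g k) ^ 2 / (2 * g k * (g (k + 1) - g k)) := by
      positivity
    rw [hv]
    linarith


/-- Corollary 1 of the paper.
For weights `g 0 < g 1 < … < g j`, all positive (with `g_{-1} = 0` when `j = 0`),
and `σ` with `g_j/(2 g_j − g_{j−1}) ≤ σ ≤ 1`, for any reals `v 0, …, v (j+1)`: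
`(σ v_{j+1} + (1−σ) v_j) · Σ (v_{s+1} − v_s) g_s ≥ (1/2) Σ (v_{s+1}² − v_s²) g_s`. -/
theorem statement2 (j : ℕ) (g v : ℕ → ℝ) (σ : ℝ)
    (hg_pos : 0 < g 0)
    (hg_mono : ∀ s, s < j → g s < g (s + 1))
    (hσ_lower : g j / (2 * g j - (if j = 0 then 0 else g (j - 1))) ≤ σ)
    (hσ_upper : σ ≤ 1) :
    (σ * v (j + 1) + (1 - σ) * v j) * (∑ s ∈ Finset.range (j + 1), (v (s + 1) - v s) * g s) ≥
      (1 / 2) * (∑ s ∈ Finset.range (j + 1), ((v (s + 1)) ^ 2 - (v s) ^ 2) * g s) := by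
  have hpos : ∀ s, s ≤ j → 0 < g s := by
    intro s
    induction s with
    | zero => exact fun _ => hg_pos
    | succ k ih => exact fun hk => (ih (by omega)).trans (hg_mono k (by omega))
  have hR := half_sum_sq_sub_add_le_right_mul j g v hpos (fun s hs => (hg_mono s hs).le)
  have hL := half_sum_sq_sub_sub_le_left_mul j g v hpos hg_mono
  have hgj := hpos j le_rfl
  have hp : 0 < g j - (if j = 0 then 0 else g (j - 1)) := by
    cases j with
    | zero => simpa using hg_pos
    | succ k => simpa using hg_mono k (by omega)
  set p := if j = 0 then 0 else g (j - 1)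
  set S := ∑ s ∈ Finset.range (j + 1), (v (s + 1) - v s) * g s
  have hden : 0 < 2 * g j - p := by linarith
  have hσ : 0 ≤ σ := (div_pos hgj hden).le.trans hσ_lower
  rw [div_le_iff₀ hden] at hσ_lower
  have hcoef : (1 - σ) * (S ^ 2 / (2 * (g j - p))) ≤ σ * (S ^ 2 / (2 * g j)) := by
    rw [← mul_div_assoc, ← mul_div_assoc, div_le_div_iff₀ (by positivity) (by positivity)]
    nlinarith [mul_nonneg (sq_nonneg S) (sub_nonneg.2 hσ_lower)]
  have h1 := mul_le_mul_of_nonneg_left hR hσ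
  have h2 := mul_le_mul_of_nonneg_left hL (sub_nonneg.2 hσ_upper)
  linarith
end

section
/- Let N ≥ 2 and M ≥ 1 be integers, h = 1/N, and let κ > 0 and c₂ > 0. For each j = 0, …, M−1 let g_0^{j+1}, …, g_j^{j+1} be reals with g_j^{j+1} > g_{j−1}^{j+1} > … > g_0^{j+1} ≥ c₂ > 0 (with g_{−1}^{1} = 0), and let σ_{j+1} satisfy g_j^{j+1}/(2 g_j^{j+1} − g_{j−1}^{j+1}) ≤ σ_{j+1} ≤ 1. Let Λ^{j+1} be linear maps on grid functions vanishing at i = 0 and i = N satisfying (−Λ^{j+1} y, y) ≥ κ ‖y‖₀² for all such grid functions y. Suppose the grid functions y^0, y^1, …, y^M (each vanishing at i = 0 and i = N) and φ^1, …, φ^M satisfy, for every j = 0, …, M−1 and every interior index i, Σ_{s=0}^{j} (y_i^{s+1} − y_i^s) g_s^{j+1} = (Λ^{j+1} y^{(σ_{j+1})})_i + φ_i^{j+1}, where y^{(σ_{j+1})} = σ_{j+1} y^{j+1} + (1 − σ_{j+1}) y^j. Then for every j = 0, …, M−1, ‖y^{j+1}‖₀² ≤ ‖y^0‖₀² + (1/(2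 κ c₂)) max_{1 ≤ m ≤ M} ‖φ^m‖₀². -/
/-- Grid inner product `(y, v) = Σ_{i=1}^{N−1} y_i v_i h` with `h = 1/N`. -/
noncomputable def gridInner (N : ℕ) (y v : ℕ → ℝ) : ℝ :=
  ∑ i ∈ Finset.Ioo 0 N, y i * v i * (1 / (N : ℝ))

lemma pos_of_pos_zero_of_lt_succ (g : ℕ → ℝ) (k : ℕ) (h0 : 0 < g 0)
    (hg : ∀ s, s < k → g s < g (s + 1)) : 0 < g k := by
  induction k with
  | zero => exact h0
  | succ k ih => exact (ih fun s hs => hg s (by omega)).trans (hg k (by omega))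

/-- Abel-summation bound for nonnegative increasing weights. -/
lemma neg_mul_sq_le_sum_weighted_sq_sub (g y : ℕ → ℝ) (p : ℝ) (k : ℕ) (h0 : 0 ≤ g 0)
    (hg : ∀ s, s < k → g s < g (s + 1)) :
    -(g k * (p - y (k + 1)) ^ 2) ≤
      ∑ s ∈ Finset.range (k + 1), g s * ((p - y s) ^ 2 - (p - y (s + 1)) ^ 2) := by
  induction k with
  | zero =>
    simp only [zero_add, Finset.sum_range_one]
    nlinarith [mul_nonneg h0 (sq_nonneg (p - y 0))]
  | succ k ih =>
    rw [Finset.sum_range_succ]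
    have h1 := ih fun s hs => hg s (by omega)
    have h2 := mul_nonneg (sub_nonneg.2 (hg k (by omega)).le) (sq_nonneg (p - y (k + 1)))
    nlinarith

/-- Alikhanov's inequality for the discrete fractional derivative with weights `g`. -/
lemma sum_weighted_sq_sub_le (g y : ℕ → ℝ) (σ : ℝ) (j : ℕ) (h0 : 0 < g 0)
    (hg : ∀ s, s < j → g s < g (s + 1))
    (hσ : g j / (2 * g j - (if j = 0 then 0 else g (j - 1))) ≤ σ) (hσ1 : σ ≤ 1) :
    ∑ s ∈ Finset.range (j + 1), g s * (y (s + 1) ^ 2 - y s ^ 2) ≤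
      2 * ((∑ s ∈ Finset.range (j + 1), (y (s + 1) - y s) * g s) *
        (σ * y (j + 1) + (1 - σ) * y j)) := by
  set p := σ * y (j + 1) + (1 - σ) * y j with hp
  suffices h : 0 ≤ ∑ s ∈ Finset.range (j + 1), g s * ((p - y s) ^ 2 - (p - y (s + 1)) ^ 2) by
    have e : ∑ s ∈ Finset.range (j + 1), g s * ((p - y s) ^ 2 - (p - y (s + 1)) ^ 2) =
        2 * ((∑ s ∈ Finset.range (j + 1), (y (s + 1) - y s) * g s) * p) -
          ∑ s ∈ Finset.range (j + 1), g s * (y (s + 1) ^ 2 - y s ^ 2) := by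
      rw [Finset.sum_mul, Finset.mul_sum, ← Finset.sum_sub_distrib]
      exact Finset.sum_congr rfl fun s _ => by ring
    linarith
  cases j with
  | zero =>
    have hσ' : 1 / 2 ≤ σ := by
      have : g 0 / (2 * g 0 - 0) = 1 / 2 := by field_simp; ring
      rwa [if_pos rfl, this] at hσ
    simp only [zero_add, Finset.sum_range_one]
    have : (p - y 0) ^ 2 - (p - y 1) ^ 2 = (2 * σ - 1) * (y 1 - y 0) ^ 2 := by
      rw [hp]; ring
    rw [this]
    exact mul_nonneg h0.le (mul_nonneg (by linarith) (sq_nonneg _))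
  | succ k =>
    rw [Finset.sum_range_succ]
    have hsum := neg_mul_sq_le_sum_weighted_sq_sub g y p k h0.le fun s hs => hg s (by omega)
    have hlt := hg k (by omega)
    have hk := pos_of_pos_zero_of_lt_succ g k h0 fun s hs => hg s (by omega)
    have hσ' : g (k + 1) * (1 - σ) ≤ (g (k + 1) - g k) * σ := by
      simp only [Nat.add_eq_zero_iff, one_ne_zero, and_false, if_false, Nat.add_sub_cancel] at hσ
      rw [div_le_iff₀ (by linarith)] at hσ
      linarith
    have hsq : 0 ≤ (g (k + 1) - g k) * σ ^ 2 - g (k + 1) * (1 - σ) ^ 2 := by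
      have hσ0 : 0 ≤ σ := by nlinarith
      have h1 := mul_le_mul_of_nonneg_right hσ' (sub_nonneg.2 hσ1)
      have h2 : 1 - σ ≤ σ := by nlinarith
      have h3 := mul_le_mul_of_nonneg_left h2 (mul_nonneg (sub_pos.2 hlt).le hσ0)
      nlinarith
    have e : g (k + 1) * ((p - y (k + 1)) ^ 2 - (p - y (k + 1 + 1)) ^ 2) -
        g k * (p - y (k + 1)) ^ 2 =
        ((g (k + 1) - g k) * σ ^ 2 - g (k + 1) * (1 - σ) ^ 2) *
          (y (k + 1 + 1) - y (k + 1)) ^ 2 := by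
      rw [hp]; ring
    have := mul_nonneg hsq (sq_nonneg (y (k + 1 + 1) - y (k + 1)))
    linarith

/-- Summation by parts bounds the last term of a sequence whose earlier terms are at most `B`. -/
lemma mul_sub_add_le_sum_weighted_sub (g E : ℕ → ℝ) (B : ℝ) (k : ℕ)
    (hg : ∀ s, s < k → g s < g (s + 1)) (hE : ∀ s, s ≤ k → E s ≤ B) :
    g k * (E (k + 1) - B) + g 0 * (B - E 0) ≤
      ∑ s ∈ Finset.range (k + 1), g s * (E (s + 1) - E s) := by
  induction k with
  | zero =>
    simp only [zero_add, Finset.sum_range_one]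
    linarith
  | succ k ih =>
    rw [Finset.sum_range_succ]
    have h1 := ih (fun s hs => hg s (by omega)) fun s hs => hE s (by omega)
    have h2 := mul_nonneg (sub_nonneg.2 (hg k (by omega)).le)
      (sub_nonneg.2 (hE (k + 1) le_rfl))
    nlinarith

lemma gridInner_self_nonneg (N : ℕ) (w : ℕ → ℝ) : 0 ≤ gridInner N w w :=
  Finset.sum_nonneg fun i _ => mul_nonneg (mul_self_nonneg _) (by positivity)

/-- Energy estimate for one time level of the scheme. -/
lemma sum_weighted_gridInner_sub_le (N j : ℕ) (κ σ : ℝ) (hκ : 0 < κ) (g : ℕ → ℝ)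
    (L f : ℕ → ℝ) (y : ℕ → ℕ → ℝ) (h0 : 0 < g 0) (hg : ∀ s, s < j → g s < g (s + 1))
    (hσ : g j / (2 * g j - (if j = 0 then 0 else g (j - 1))) ≤ σ) (hσ1 : σ ≤ 1)
    (hL : κ * gridInner N (fun i => σ * y (j + 1) i + (1 - σ) * y j i)
        (fun i => σ * y (j + 1) i + (1 - σ) * y j i) ≤
      gridInner N (fun i => -L i) (fun i => σ * y (j + 1) i + (1 - σ) * y j i))
    (hscheme : ∀ i, 0 < i → i < N →
      ∑ s ∈ Finset.range (j + 1), (y (s + 1) i - y s i) * g s = L i + f i) :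
    ∑ s ∈ Finset.range (j + 1),
        g s * (gridInner N (y (s + 1)) (y (s + 1)) - gridInner N (y s) (y s)) ≤
      1 / (2 * κ) * gridInner N f f := by
  set v : ℕ → ℝ := fun i => σ * y (j + 1) i + (1 - σ) * y j i with hv
  have hpoint : ∀ i ∈ Finset.Ioo 0 N,
      (∑ s ∈ Finset.range (j + 1), g s * (y (s + 1) i ^ 2 - y s i ^ 2)) * (1 / (N : ℝ)) ≤
        2 * (κ * (v i * v i * (1 / (N : ℝ)))) - 2 * (-L i * v i * (1 / (N : ℝ))) +
          1 / (2 * κ) * (f i * f i * (1 / (N : ℝ))) := by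
    intro i hi
    rw [Finset.mem_Ioo] at hi
    have hA := sum_weighted_sq_sub_le g (fun s => y s i) σ j h0 hg hσ hσ1
    simp only [hscheme i hi.1 hi.2] at hA
    change _ ≤ 2 * ((L i + f i) * v i) at hA
    have hyoung : 2 * (f i * v i) ≤ 2 * κ * (v i * v i) + 1 / (2 * κ) * (f i * f i) := by
      have e : 2 * κ * (v i * v i) + 1 / (2 * κ) * (f i * f i) - 2 * (f i * v i) =
          1 / (2 * κ) * (2 * κ * v i - f i) ^ 2 := by
        field_simp; ring
      have : 0 ≤ 1 / (2 * κ) * (2 * κ * v i - f i) ^ 2 := by positivity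
      linarith
    calc _ ≤ (2 * κ * (v i * v i) - 2 * (-L i * v i) + 1 / (2 * κ) * (f i * f i)) *
          (1 / (N : ℝ)) := mul_le_mul_of_nonneg_right (by linarith) (by positivity)
      _ = _ := by ring
  have hsum := Finset.sum_le_sum hpoint
  rw [Finset.sum_add_distrib, Finset.sum_sub_distrib, ← Finset.mul_sum, ← Finset.mul_sum,
    ← Finset.mul_sum, ← Finset.mul_sum] at hsum
  change _ ≤ 2 * (κ * gridInner N v v) - 2 * gridInner N (fun i => -L i) v +
    1 / (2 * κ) * gridInner N f f at hsum
  have e : ∑ s ∈ Finset.range (j + 1),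
        g s * (gridInner N (y (s + 1)) (y (s + 1)) - gridInner N (y s) (y s)) =
      ∑ i ∈ Finset.Ioo 0 N,
        (∑ s ∈ Finset.range (j + 1), g s * (y (s + 1) i ^ 2 - y s i ^ 2)) * (1 / (N : ℝ)) := by
    simp only [gridInner, ← Finset.sum_sub_distrib, Finset.mul_sum, Finset.sum_mul]
    rw [Finset.sum_comm]
    exact Finset.sum_congr rfl fun i _ => Finset.sum_congr rfl fun s _ => by ring
  linarith

/-- Theorem 1 of the paper (stability of the general family of schemes).
If `g_j^{j+1} > … > g_0^{j+1} ≥ c₂ > 0`, `g_j^{j+1}/(2g_j^{j+1} − g_{j−1}^{j+1}) ≤ σ_{j+1} ≤ 1`,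
and `(−Λ^{j+1} y, y) ≥ κ‖y‖₀²` for grid functions vanishing at the boundary, then any solution
of the scheme satisfies `‖y^{j+1}‖₀² ≤ ‖y^0‖₀² + (1/(2κc₂)) max_{1≤m≤M} ‖φ^m‖₀²`. -/
theorem statement3 (N M : ℕ) (hN : 2 ≤ N) (hM : 1 ≤ M)
    (κ c₂ : ℝ) (hκ : 0 < κ) (hc₂ : 0 < c₂)
    (g : ℕ → ℕ → ℝ)  -- `g j s` is `g_s^{j+1}`
    (σ : ℕ → ℝ)      -- `σ j` is `σ_{j+1}`
    (Λ : ℕ → (ℕ → ℝ) →ₗ[ℝ] (ℕ → ℝ))  -- `Λ j` is `Λ^{j+1}`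
    (y φ : ℕ → ℕ → ℝ)  -- `y j i` is `y_i^j`; `φ m i` is `φ_i^m`
    (hg_mono : ∀ j, j < M → ∀ s, s < j → g j s < g j (s + 1))
    (hg_low : ∀ j, j < M → c₂ ≤ g j 0)
    (hσ_low : ∀ j, j < M →
      g j j / (2 * g j j - (if j = 0 then 0 else g j (j - 1))) ≤ σ j)
    (hσ_up : ∀ j, j < M → σ j ≤ 1)
    (hΛ : ∀ j, j < M → ∀ w : ℕ → ℝ, w 0 = 0 → w N = 0 →
      gridInner N (fun i => -(Λ j w i)) w ≥ κ * gridInner N w w)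
    (hy_bc : ∀ j, j ≤ M → y j 0 = 0 ∧ y j N = 0)
    (hscheme : ∀ j, j < M → ∀ i, 0 < i → i < N →
      ∑ s ∈ Finset.range (j + 1), (y (s + 1) i - y s i) * g j s =
        Λ j (fun i' => σ j * y (j + 1) i' + (1 - σ j) * y j i') i + φ (j + 1) i) :
    ∀ j, j < M →
      gridInner N (y (j + 1)) (y (j + 1)) ≤
        gridInner N (y 0) (y 0) +
          (1 / (2 * κ * c₂)) *
            (Finset.Icc 1 M).sup' (Finset.nonempty_Icc.mpr hM)
              (fun m => gridInner N (φ m) (φ m)) := by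
  set F := (Finset.Icc 1 M).sup' (Finset.nonempty_Icc.mpr hM)
    (fun m => gridInner N (φ m) (φ m)) with hF
  have hφ : ∀ m, 1 ≤ m → m ≤ M → gridInner N (φ m) (φ m) ≤ F := fun m h1 h2 =>
    Finset.le_sup' (fun m => gridInner N (φ m) (φ m)) (Finset.mem_Icc.2 ⟨h1, h2⟩)
  have hF0 : 0 ≤ F := (gridInner_self_nonneg N _).trans (hφ 1 le_rfl hM)
  have hbound : ∀ n, n ≤ M → gridInner N (y n) (y n) ≤
      gridInner N (y 0) (y 0) + (1 / (2 * κ * c₂)) * F := by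
    intro n
    induction n using Nat.strong_induction_on with
    | _ n ih =>
      intro hn
      cases n with
      | zero => exact le_add_of_nonneg_right (by positivity)
      | succ j =>
        have hj : j < M := hn
        have h0 : 0 < g j 0 := hc₂.trans_le (hg_low j hj)
        have henergy := sum_weighted_gridInner_sub_le N j κ (σ j) hκ (g j) _ (φ (j + 1)) y h0
          (hg_mono j hj) (hσ_low j hj) (hσ_up j hj)
          (hΛ j hj _ (by simp [(hy_bc j hj.le).1, (hy_bc (j + 1) hn).1])
            (by simp [(hy_bc j hj.le).2, (hy_bc (j + 1) hn).2]))
          (hscheme j hj)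
        have hparts := mul_sub_add_le_sum_weighted_sub (g j)
          (fun s => gridInner N (y s) (y s)) _ j (hg_mono j hj)
          fun s hs => ih s (by omega) (by omega)
        have hdata : 1 / (2 * κ) * gridInner N (φ (j + 1)) (φ (j + 1)) ≤
            g j 0 * (1 / (2 * κ * c₂) * F) :=
          calc _ ≤ 1 / (2 * κ) * F :=
                mul_le_mul_of_nonneg_left (hφ _ (by omega) hn) (by positivity)
            _ = c₂ * (1 / (2 * κ * c₂) * F) := by field_simp
            _ ≤ _ := mul_le_mul_of_nonneg_right (hg_low j hj) (by positivity)
        have hgj := pos_of_pos_zero_of_lt_succ (g j) j h0 (hg_mono j hj)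
        rw [add_sub_cancel_left] at hparts
        by_contra! hcon
        have := mul_pos hgj (sub_pos.2 hcon)
        linarith
  exact fun j hj => hbound (j + 1) hj
end

section
/- For all α ∈ (0,1), with σ = 1 − α/2, and all integers s ≥ 1, one has (1−α)/(s+σ)^α < a_s^{(α)} < (1−α)/(s+σ−1)^α. -/
/-- `a_l^{(α)}`: `a_0 = σ^{1−α}`, `a_l = (l+σ)^{1−α} − (l−1+σ)^{1−α}` for `l ≥ 1`. -/
noncomputable def aCoef (α σ : ℝ) (l : ℕ) : ℝ :=
  if l = 0 then σ ^ (1 - α)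
  else ((l : ℝ) + σ) ^ (1 - α) - ((l : ℝ) - 1 + σ) ^ (1 - α)

/-- `b_l^{(α)} = ((l+σ)^{2−α} − (l−1+σ)^{2−α})/(2−α) − ((l+σ)^{1−α} + (l−1+σ)^{1−α})/2` for `l ≥ 1`. -/
noncomputable def bCoef (α σ : ℝ) (l : ℕ) : ℝ :=
  (((l : ℝ) + σ) ^ (2 - α) - ((l : ℝ) - 1 + σ) ^ (2 - α)) / (2 - α) -
    (((l : ℝ) + σ) ^ (1 - α) + ((l : ℝ) - 1 + σ) ^ (1 - α)) / 2

/-- Mean value bounds for the unit increment of `x ↦ x ^ (1 - α)`. -/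
theorem rpow_one_sub_unit_increment_bounds {α x : ℝ} (h₀ : 0 < α) (h₁ : α < 1) (hx : 0 < x) :
    (1 - α) / (x + 1) ^ α < (x + 1) ^ (1 - α) - x ^ (1 - α) ∧
      (x + 1) ^ (1 - α) - x ^ (1 - α) < (1 - α) / x ^ α := by
  obtain ⟨c, ⟨hxc, hcx⟩, hc⟩ := exists_hasDerivAt_eq_slope
    (fun y : ℝ => y ^ (1 - α)) (fun y => (1 - α) * y ^ (1 - α - 1)) (lt_add_one x)
    (fun y _ => (Real.continuousAt_rpow_const y _ (Or.inr (by linarith))).continuousWithinAt)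
    (fun y hy => Real.hasDerivAt_rpow_const (Or.inl (hx.trans hy.1).ne'))
  have hc₀ : 0 < c := hx.trans hxc
  have hpos : 0 < 1 - α := sub_pos.2 h₁
  have key : (x + 1) ^ (1 - α) - x ^ (1 - α) = (1 - α) / c ^ α := by
    rw [add_sub_cancel_left, div_one, show 1 - α - 1 = -α by ring, Real.rpow_neg hc₀.le] at hc
    rw [← hc, div_eq_mul_inv]
  rw [key]
  exact ⟨div_lt_div_of_pos_left hpos (by positivity) (Real.rpow_lt_rpow hc₀.le hcx h₀),
    div_lt_div_of_pos_left hpos (by positivity) (Real.rpow_lt_rpow hx.le hxc h₀)⟩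

/-- Lemma 3, inequality (14) of the paper:
for all `α ∈ (0,1)`, `σ = 1 − α/2`, and integers `s ≥ 1`,
`(1−α)/(s+σ)^α < a_s^{(α)} < (1−α)/(s+σ−1)^α`. -/
theorem statement4 (α σ : ℝ) (hα : α ∈ Set.Ioo (0 : ℝ) 1) (hσ : σ = 1 - α / 2)
    (s : ℕ) (hs : 1 ≤ s) :
    (1 - α) / (((s : ℝ) + σ) ^ α) < aCoef α σ s ∧
      aCoef α σ s < (1 - α) / (((s : ℝ) + σ - 1) ^ α) := by
  obtain ⟨h₀, h₁⟩ := hα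
  have hs' : (1 : ℝ) ≤ s := by exact_mod_cast hs
  have h := rpow_one_sub_unit_increment_bounds (x := (s : ℝ) - 1 + σ) h₀ h₁ (by linarith)
  rw [show (s : ℝ) - 1 + σ + 1 = s + σ by ring] at h
  rw [aCoef, if_neg (by lia), show (s : ℝ) + σ - 1 = s - 1 + σ by ring]
  exact h
end

section
/- For all α ∈ (0,1), with σ = 1 − α/2, and all integers s ≥ 1, one has α(1−α)/(s+σ+1)^{α+1} < a_s^{(α)} − a_{s+1}^{(α)} < α(1−α)/(s+σ−1)^{α+1}. -/
/-- Mean value theorem for `t ↦ t ^ p` on an interval of length one. -/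
theorem exists_rpow_sub_rpow_eq (p : ℝ) {a : ℝ} (ha : 0 < a) :
    ∃ c ∈ Set.Ioo a (a + 1), (a + 1) ^ p - a ^ p = p * c ^ (p - 1) := by
  have hd : ∀ t ∈ Set.Icc a (a + 1), HasDerivAt (fun y : ℝ => y ^ p) (p * t ^ (p - 1)) t :=
    fun t ht => Real.hasDerivAt_rpow_const (Or.inl (ha.trans_le ht.1).ne')
  obtain ⟨c, hc, h⟩ := exists_hasDerivAt_eq_slope (fun y : ℝ => y ^ p)
    (fun t => p * t ^ (p - 1)) (lt_add_one a)
    (fun t ht => (hd t ht).continuousAt.continuousWithinAt)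
    (fun t ht => hd t (Set.Ioo_subset_Icc_self ht))
  refine ⟨c, hc, ?_⟩
  simpa using h.symm

/-- Mean value form of the second difference of `t ↦ t ^ p`. -/
theorem exists_rpow_second_difference_eq (p : ℝ) {a : ℝ} (ha : 0 < a) :
    ∃ c ∈ Set.Ioo a (a + 2),
      ((a + 1) ^ p - a ^ p) - ((a + 2) ^ p - (a + 1) ^ p) = p * (1 - p) * c ^ (p - 2) := by
  have hd : ∀ t ∈ Set.Icc a (a + 1), HasDerivAt (fun y : ℝ => (y + 1) ^ p - y ^ p)
      (p * (t + 1) ^ (p - 1) - p * t ^ (p - 1)) t := by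
    intro t ht
    have ht0 : 0 < t := ha.trans_le ht.1
    have h1 : HasDerivAt (fun y : ℝ => (y + 1) ^ p) (p * (t + 1) ^ (p - 1)) t :=
      (Real.hasDerivAt_rpow_const (Or.inl (by positivity))).comp_add_const t 1
    exact h1.sub (Real.hasDerivAt_rpow_const (Or.inl ht0.ne'))
  obtain ⟨b, hb, h⟩ := exists_hasDerivAt_eq_slope (fun y : ℝ => (y + 1) ^ p - y ^ p)
    (fun t => p * (t + 1) ^ (p - 1) - p * t ^ (p - 1)) (lt_add_one a)
    (fun t ht => (hd t ht).continuousAt.continuousWithinAt)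
    (fun t ht => hd t (Set.Ioo_subset_Icc_self ht))
  obtain ⟨c, hc, hbc⟩ := exists_rpow_sub_rpow_eq (p - 1) (ha.trans hb.1)
  refine ⟨c, ⟨hb.1.trans hc.1, by linarith [hc.2, hb.2]⟩, ?_⟩
  rw [add_sub_cancel_left, div_one, show a + 1 + 1 = a + 2 by ring] at h
  rw [show p - 1 - 1 = p - 2 by ring] at hbc
  linear_combination h - p * hbc

/-- Lemma 3, inequality (15) of the paper:
for all `α ∈ (0,1)`, `σ = 1 − α/2`, and integers `s ≥ 1`,
`α(1−α)/(s+σ+1)^{α+1} < a_s^{(α)} − a_{s+1}^{(α)} < α(1−α)/(s+σ−1)^{α+1}`. -/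
theorem statement5 (α σ : ℝ) (hα : α ∈ Set.Ioo (0 : ℝ) 1) (hσ : σ = 1 - α / 2)
    (s : ℕ) (hs : 1 ≤ s) :
    α * (1 - α) / (((s : ℝ) + σ + 1) ^ (α + 1)) < aCoef α σ s - aCoef α σ (s + 1) ∧
      aCoef α σ s - aCoef α σ (s + 1) < α * (1 - α) / (((s : ℝ) + σ - 1) ^ (α + 1)) := by
  obtain ⟨h0, h1⟩ := hα
  have hs' : (1 : ℝ) ≤ s := by exact_mod_cast hs
  have ha : 0 < (s : ℝ) + σ - 1 := by linarith
  obtain ⟨c, hc, h⟩ := exists_rpow_second_difference_eq (1 - α) ha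
  have hc0 : 0 < c := ha.trans hc.1
  have hdiff : aCoef α σ s - aCoef α σ (s + 1) = α * (1 - α) / c ^ (α + 1) := by
    have hpow : c ^ (1 - α - 2) = (c ^ (α + 1))⁻¹ := by
      rw [← Real.rpow_neg hc0.le]
      congr 1
      ring
    rw [hpow] at h
    rw [aCoef, aCoef, if_neg (by lia), if_neg (by lia), div_eq_mul_inv]
    push_cast
    convert h using 1
    · congr! 3 <;> ring
    · ring
  have hnum : 0 < α * (1 - α) := mul_pos h0 (by linarith)
  rw [hdiff]
  constructor
  · exact div_lt_div_of_pos_left hnum (by positivity)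
      (Real.rpow_lt_rpow hc0.le (by linarith [hc.2]) (by linarith))
  · exact div_lt_div_of_pos_left hnum (by positivity)
      (Real.rpow_lt_rpow ha.le hc.1 (by linarith))
end

section
/- For all α ∈ (0,1), with σ = 1 − α/2, and all integers s ≥ 1, one has α(1−α)/(12 (s+σ)^{α+1}) < b_s^{(α)} < α(1−α)/(12 (s+σ−1)^{α+1}). -/
/-- Lower bound for the error of the trapezoidal rule under an upper bound on the second
derivative `f''` of the integrand; `F` is an antiderivative of `f`. -/
theorem mul_cube_div_lt_sub_trapezoid {F f f' f'' : ℝ → ℝ} {a b K : ℝ} (hab : a < b)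
    (hF : ∀ x ∈ Set.Icc a b, HasDerivAt F (f x) x)
    (hf : ∀ x ∈ Set.Icc a b, HasDerivAt f (f' x) x)
    (hf' : ∀ x ∈ Set.Icc a b, HasDerivAt f' (f'' x) x)
    (hK : ∀ x ∈ Set.Ioo a b, K < -f'' x) :
    K * (b - a) ^ 3 / 12 < F b - F a - (b - a) * (f a + f b) / 2 := by
  set G : ℝ → ℝ := fun x => F x - F a - (x - a) * (f a + f x) / 2 - K * (x - a) ^ 3 / 12 with hG
  set H : ℝ → ℝ := fun x => (f x - f a) / 2 - (x - a) * f' x / 2 - K * (x - a) ^ 2 / 4 with hH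
  have hsub (x : ℝ) : HasDerivAt (fun x => x - a) 1 x := (hasDerivAt_id x).sub_const a
  have hGH : ∀ x ∈ Set.Icc a b, HasDerivAt G (H x) x := fun x hx => by
    refine ((((hF x hx).sub_const (F a)).sub
      (((hsub x).mul ((hf x hx).const_add (f a))).div_const 2)).sub
      ((((hsub x).pow 3).const_mul K).div_const 12)).congr_deriv ?_
    simp only [hH]
    push_cast
    ring
  have hHder : ∀ x ∈ Set.Icc a b, HasDerivAt H (-(x - a) * (f'' x + K) / 2) x := fun x hx => by
    refine (((((hf x hx).sub_const (f a)).div_const 2).sub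
      (((hsub x).mul (hf' x hx)).div_const 2)).sub
      ((((hsub x).pow 2).const_mul K).div_const 4)).congr_deriv ?_
    push_cast
    ring
  have hHmono : StrictMonoOn H (Set.Icc a b) := by
    refine strictMonoOn_of_deriv_pos (convex_Icc a b)
      (fun x hx => (hHder x hx).continuousAt.continuousWithinAt) fun x hx => ?_
    rw [interior_Icc] at hx
    rw [(hHder x (Set.Ioo_subset_Icc_self hx)).deriv]
    nlinarith [mul_pos (sub_pos.2 hx.1) (sub_pos.2 (hK x hx))]
  have hGmono : StrictMonoOn G (Set.Icc a b) := by
    refine strictMonoOn_of_deriv_pos (convex_Icc a b)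
      (fun x hx => (hGH x hx).continuousAt.continuousWithinAt) fun x hx => ?_
    rw [interior_Icc] at hx
    rw [(hGH x (Set.Ioo_subset_Icc_self hx)).deriv]
    have h := hHmono (Set.left_mem_Icc.2 hab.le) (Set.Ioo_subset_Icc_self hx) hx.1
    simpa [hH] using h
  have h := hGmono (Set.left_mem_Icc.2 hab.le) (Set.right_mem_Icc.2 hab.le) hab
  simp only [hG, sub_self, zero_mul, zero_div, ne_eq, OfNat.ofNat_ne_zero, not_false_eq_true,
    zero_pow, mul_zero] at h
  linarith

/-- Upper bound for the error of the trapezoidal rule under a lower bound on the second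
derivative `f''` of the integrand; `F` is an antiderivative of `f`. -/
theorem sub_trapezoid_lt_mul_cube_div {F f f' f'' : ℝ → ℝ} {a b K : ℝ} (hab : a < b)
    (hF : ∀ x ∈ Set.Icc a b, HasDerivAt F (f x) x)
    (hf : ∀ x ∈ Set.Icc a b, HasDerivAt f (f' x) x)
    (hf' : ∀ x ∈ Set.Icc a b, HasDerivAt f' (f'' x) x)
    (hK : ∀ x ∈ Set.Ioo a b, -f'' x < K) :
    F b - F a - (b - a) * (f a + f b) / 2 < K * (b - a) ^ 3 / 12 := by
  have h := mul_cube_div_lt_sub_trapezoid (F := -F) (f := -f) (f' := -f') (f'' := -f'')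
    (K := -K) hab (fun x hx => (hF x hx).neg) (fun x hx => (hf x hx).neg)
    (fun x hx => (hf' x hx).neg) fun x hx => by simpa using neg_lt_neg (hK x hx)
  simp only [Pi.neg_apply] at h
  linarith

/-- Lemma 3, inequality (16) of the paper:
for all `α ∈ (0,1)`, `σ = 1 − α/2`, and integers `s ≥ 1`,
`α(1−α)/(12(s+σ)^{α+1}) < b_s^{(α)} < α(1−α)/(12(s+σ−1)^{α+1})`. -/
theorem statement6 (α σ : ℝ) (hα : α ∈ Set.Ioo (0 : ℝ) 1) (hσ : σ = 1 - α / 2)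
    (s : ℕ) (hs : 1 ≤ s) :
    α * (1 - α) / (12 * ((s : ℝ) + σ) ^ (α + 1)) < bCoef α σ s ∧
      bCoef α σ s < α * (1 - α) / (12 * ((s : ℝ) + σ - 1) ^ (α + 1)) := by
  obtain ⟨hα0, hα1⟩ := hα
  have hs' : (1 : ℝ) ≤ s := by exact_mod_cast hs
  have ha : 0 < (s : ℝ) - 1 + σ := by linarith
  have hab : (s : ℝ) - 1 + σ < s + σ := by linarith
  have hc : 0 < α * (1 - α) := mul_pos hα0 (sub_pos.2 hα1)
  have hpos : ∀ x ∈ Set.Icc ((s : ℝ) - 1 + σ) (s + σ), 0 < x := fun x hx => ha.trans_le hx.1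
  have hF : ∀ x ∈ Set.Icc ((s : ℝ) - 1 + σ) (s + σ),
      HasDerivAt (fun x : ℝ => x ^ (2 - α) / (2 - α)) (x ^ (1 - α)) x := fun x hx => by
    refine ((Real.hasDerivAt_rpow_const (Or.inl (hpos x hx).ne')).div_const _).congr_deriv ?_
    rw [mul_div_cancel_left₀ _ (by linarith : 2 - α ≠ 0)]
    ring_nf
  have hf : ∀ x ∈ Set.Icc ((s : ℝ) - 1 + σ) (s + σ),
      HasDerivAt (fun x : ℝ => x ^ (1 - α)) ((1 - α) * x ^ (-α)) x := fun x hx => by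
    refine (Real.hasDerivAt_rpow_const (Or.inl (hpos x hx).ne')).congr_deriv ?_
    ring_nf
  have hf' : ∀ x ∈ Set.Icc ((s : ℝ) - 1 + σ) (s + σ), HasDerivAt
      (fun x : ℝ => (1 - α) * x ^ (-α)) (-(α * (1 - α) / x ^ (α + 1))) x := fun x hx => by
    refine ((Real.hasDerivAt_rpow_const (Or.inl (hpos x hx).ne')).const_mul _).congr_deriv ?_
    rw [← neg_add', Real.rpow_neg (hpos x hx).le]
    ring
  have hb : bCoef α σ s = ((s : ℝ) + σ) ^ (2 - α) / (2 - α) - ((s : ℝ) - 1 + σ) ^ (2 - α) / (2 - α)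
      - ((s : ℝ) + σ - (s - 1 + σ)) * (((s : ℝ) - 1 + σ) ^ (1 - α) + ((s : ℝ) + σ) ^ (1 - α)) / 2 := by
    rw [bCoef]
    ring
  have hlen : (s : ℝ) + σ - (s - 1 + σ) = 1 := by ring
  rw [hb]
  constructor
  · convert mul_cube_div_lt_sub_trapezoid (K := α * (1 - α) / ((s : ℝ) + σ) ^ (α + 1))
      hab hF hf hf' fun x hx => ?_ using 1
    · rw [hlen, one_pow, mul_one, div_div, mul_comm 12]
    · have hx0 := ha.trans hx.1
      rw [neg_neg]
      exact div_lt_div_of_pos_left hc (by positivity)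
        (Real.rpow_lt_rpow hx0.le hx.2 (by linarith))
  · convert sub_trapezoid_lt_mul_cube_div (K := α * (1 - α) / ((s : ℝ) - 1 + σ) ^ (α + 1))
      hab hF hf hf' fun x hx => ?_ using 1
    · rw [hlen, one_pow, mul_one, div_div, mul_comm 12, sub_add_eq_add_sub]
    · rw [neg_neg]
      exact div_lt_div_of_pos_left hc (by positivity)
        (Real.rpow_lt_rpow ha.le hx.1 (by linarith))
end

section
/- For all α ∈ (0,1), with σ = 1 − α/2, and all integers s ≥ 1, one has a_s^{(α)} − b_s^{(α)} > ((1−α)/2) (s+σ)^{−α}. -/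
/-- The tangent line of `t ↦ t ^ p` at `y` lies strictly below the graph at `y - 1` if `1 < p`. -/
theorem rpow_sub_mul_rpow_lt_sub_one_rpow {y p : ℝ} (hy : 1 ≤ y) (hp : 1 < p) :
    y ^ p - p * y ^ (p - 1) < (y - 1) ^ p := by
  have hy0 : 0 < y := by linarith
  have hinv : y⁻¹ ≤ 1 := inv_le_one_of_one_le₀ hy
  have h := one_add_mul_self_lt_rpow_one_add (s := -y⁻¹) (by linarith)
    (neg_ne_zero.mpr (inv_ne_zero hy0.ne')) hp
  calc y ^ p - p * y ^ (p - 1) = y ^ p * (1 + p * -y⁻¹) := by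
        rw [Real.rpow_sub_one hy0.ne']; ring
    _ < y ^ p * (1 + -y⁻¹) ^ p := by gcongr
    _ = (y - 1) ^ p := by
        rw [← Real.mul_rpow hy0.le (by linarith)]
        congr 1
        field_simp
        ring

/-- The tangent line of `t ↦ t ^ p` at `y` lies above the graph at `y - 1` if `0 ≤ p ≤ 1`. -/
theorem sub_one_rpow_le_rpow_sub_mul_rpow {y p : ℝ} (hy : 1 ≤ y) (hp0 : 0 ≤ p) (hp1 : p ≤ 1) :
    (y - 1) ^ p ≤ y ^ p - p * y ^ (p - 1) := by
  have hy0 : 0 < y := by linarith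
  have hinv : y⁻¹ ≤ 1 := inv_le_one_of_one_le₀ hy
  have h := rpow_one_add_le_one_add_mul_self (s := -y⁻¹) (by linarith) hp0 hp1
  calc (y - 1) ^ p = y ^ p * (1 + -y⁻¹) ^ p := by
        rw [← Real.mul_rpow hy0.le (by linarith)]
        congr 1
        field_simp
        ring
    _ ≤ y ^ p * (1 + p * -y⁻¹) := by gcongr
    _ = y ^ p - p * y ^ (p - 1) := by
        rw [Real.rpow_sub_one hy0.ne']; ring

/-- Lemma 4, inequality (17) of the paper:
for all `α ∈ (0,1)`, `σ = 1 − α/2`, and integers `s ≥ 1`,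
`a_s^{(α)} − b_s^{(α)} > ((1−α)/2)(s+σ)^{−α}`. -/
theorem statement7 (α σ : ℝ) (hα : α ∈ Set.Ioo (0 : ℝ) 1) (hσ : σ = 1 - α / 2)
    (s : ℕ) (hs : 1 ≤ s) :
    aCoef α σ s - bCoef α σ s > ((1 - α) / 2) * ((s : ℝ) + σ) ^ (-α) := by
  obtain ⟨hα0, hα1⟩ := hα
  have hs1 : (1 : ℝ) ≤ s := by exact_mod_cast hs
  have hy : 1 ≤ (s : ℝ) + σ := by linarith
  have hlower := rpow_sub_mul_rpow_lt_sub_one_rpow (p := 2 - α) hy (by linarith)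
  have hupper := sub_one_rpow_le_rpow_sub_mul_rpow (p := 1 - α) hy (by linarith) (by linarith)
  rw [show 2 - α - 1 = 1 - α by ring] at hlower
  rw [show 1 - α - 1 = -α by ring] at hupper
  rw [aCoef, if_neg (by lia), bCoef, show (s : ℝ) - 1 + σ = s + σ - 1 by ring]
  have hquot : (((s : ℝ) + σ) ^ (2 - α) - ((s : ℝ) + σ - 1) ^ (2 - α)) / (2 - α) <
      ((s : ℝ) + σ) ^ (1 - α) := by
    rw [div_lt_iff₀ (by linarith)]
    linarith
  linarith
end

section
/- For all α ∈ (0,1), with σ = 1 − α/2, one has (2σ−1)(a_0^{(α)} + b_1^{(α)}) − σ(a_1^{(α)} + b_2^{(α)} − b_1^{(α)}) > α(1−α)/(4σ(1+σ)^α). -/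
/-- Strict concavity of `y ↦ y ^ β`, as a tangent line bound at `x`. -/
theorem add_one_rpow_lt_mul_one_add_div {x β : ℝ} (hx : 0 < x) (hβ0 : 0 < β) (hβ1 : β < 1) :
    (x + 1) ^ β < x ^ β * (1 + β / x) := by
  have hB : (1 + 1 / x) ^ β < 1 + β * (1 / x) :=
    rpow_one_add_lt_one_add_mul_self (by linarith [one_div_pos.mpr hx])
      (one_div_pos.mpr hx).ne' hβ0 hβ1
  calc (x + 1) ^ β = (x * (1 + 1 / x)) ^ β := by
        congr 1
        field_simp
    _ = x ^ β * (1 + 1 / x) ^ β := Real.mul_rpow hx.le (by positivity)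
    _ < x ^ β * (1 + β / x) := by
        rw [← mul_one_div β x]
        exact mul_lt_mul_of_pos_left hB (Real.rpow_pos_of_pos hx β)

/-- For `σ = 1 − α/2` the powers of `σ` cancel, leaving only powers of `1 + σ` and `2 + σ`. -/
theorem coef_combination_eq {α σ : ℝ} (hα : α < 2) (hσ : σ = 1 - α / 2) :
    (2 * σ - 1) * (aCoef α σ 0 + bCoef α σ 1) -
        σ * (aCoef α σ 1 + bCoef α σ 2 - bCoef α σ 1) =
      (1 + σ) ^ (1 - α) * (1 + (1 - α) / (2 * σ)) - (1 + σ + 1) ^ (1 - α) := by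
  obtain rfl : α = 2 - 2 * σ := by linarith
  have hσ0 : 0 < σ := by linarith
  have succ_rpow : ∀ y : ℝ, 0 < y →
      y ^ (2 - (2 - 2 * σ)) = y ^ (1 - (2 - 2 * σ)) * y := fun y hy => by
    rw [← Real.rpow_add_one hy.ne']
    congr 1
    ring
  have h1 : ((1 : ℕ) : ℝ) + σ = 1 + σ := by push_cast; ring
  have h2 : ((1 : ℕ) : ℝ) - 1 + σ = σ := by push_cast; ring
  have h3 : ((2 : ℕ) : ℝ) + σ = 1 + σ + 1 := by push_cast; ring
  have h4 : ((2 : ℕ) : ℝ) - 1 + σ = 1 + σ := by push_cast; ring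
  simp only [aCoef, bCoef, if_true, one_ne_zero, if_false, h1, h2, h3, h4]
  rw [succ_rpow σ hσ0, succ_rpow (1 + σ) (by linarith), succ_rpow (1 + σ + 1) (by linarith)]
  generalize (1 + σ + 1) ^ (1 - (2 - 2 * σ)) = C
  generalize (1 + σ) ^ (1 - (2 - 2 * σ)) = B
  generalize σ ^ (1 - (2 - 2 * σ)) = A
  rw [show 2 - (2 - 2 * σ) = 2 * σ by ring]
  field_simp
  ring

/-- Lemma 4, inequality (18) of the paper:
for all `α ∈ (0,1)`, `σ = 1 − α/2`,
`(2σ−1)(a_0^{(α)} + b_1^{(α)}) − σ(a_1^{(α)} + b_2^{(α)} − b_1^{(α)}) > α(1−α)/(4σ(1+σ)^α)`. -/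
theorem statement8 (α σ : ℝ) (hα : α ∈ Set.Ioo (0 : ℝ) 1) (hσ : σ = 1 - α / 2) :
    (2 * σ - 1) * (aCoef α σ 0 + bCoef α σ 1) -
        σ * (aCoef α σ 1 + bCoef α σ 2 - bCoef α σ 1) >
      α * (1 - α) / (4 * σ * (1 + σ) ^ α) := by
  obtain ⟨hα0, hα1⟩ := hα
  have hσ0 : 0 < σ := by linarith
  have hx : 0 < 1 + σ := by linarith
  rw [coef_combination_eq (by linarith) hσ]
  have hT := add_one_rpow_lt_mul_one_add_div hx (sub_pos.mpr hα1) (by linarith : 1 - α < 1)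
  have hR : α * (1 - α) / (4 * σ * (1 + σ) ^ α) =
      (1 + σ) ^ (1 - α) * (1 + (1 - α) / (2 * σ)) -
        (1 + σ) ^ (1 - α) * (1 + (1 - α) / (1 + σ)) := by
    have hP : (1 + σ) ^ α ≠ 0 := (Real.rpow_pos_of_pos hx α).ne'
    rw [Real.rpow_sub hx, Real.rpow_one]
    obtain rfl : α = 2 - 2 * σ := by linarith
    generalize (1 + σ) ^ (2 - 2 * σ) = P at hP ⊢
    field_simp
    ring
  rw [hR]
  linarith
end

section
/- Let α ∈ (0,1), σ = 1 − α/2, τ > 0, j ≥ 1 an integer, and let λ : [0, (j+σ)τ] → ℝ be positive and nonincreasing. Then the coefficient c_j^{(α)} = λ_{j+σ−1/2} a_j^{(α)} − λ_{j+σ} b_j^{(α)} satisfies c_j^{(α)} > ((1−α)/2) · λ_{j+σ} / (j+σ)^α. -/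
/-- `c_s^{(α)}` for the `_λ`L2-1`_σ` formula at the level `j`, with weight `λ` sampled at
multiples of the time step `τ` (`λ_r = λ(rτ)`):
if `j = 0`, `c_0 = λ_{σ−1/2} a_0`; if `j ≥ 1`, `c_0 = λ_{σ−1/2} a_0 + λ_σ b_1`,
`c_s = λ_{s+σ−1/2} a_s + λ_{s+σ} b_{s+1} − λ_{s+σ} b_s` for `1 ≤ s ≤ j−1`, and
`c_j = λ_{j+σ−1/2} a_j − λ_{j+σ} b_j`. -/
noncomputable def cCoef (α σ τ : ℝ) (lam : ℝ → ℝ) (j s : ℕ) : ℝ :=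
  if j = 0 then lam ((σ - 1 / 2) * τ) * aCoef α σ 0
  else if s = 0 then lam ((σ - 1 / 2) * τ) * aCoef α σ 0 + lam (σ * τ) * bCoef α σ 1
  else if s = j then
    lam (((j : ℝ) + σ - 1 / 2) * τ) * aCoef α σ j - lam (((j : ℝ) + σ) * τ) * bCoef α σ j
  else
    lam (((s : ℝ) + σ - 1 / 2) * τ) * aCoef α σ s + lam (((s : ℝ) + σ) * τ) * bCoef α σ (s + 1) -
      lam (((s : ℝ) + σ) * τ) * bCoef α σ s

open Set in
/-- The derivative of the auxiliary function is `(t - x + 3/2) (1 - α) (t ^ (-α) - x ^ (-α))`,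
which is nonnegative on `[x - 1, x]`; comparing the endpoints gives the bound. -/
theorem one_sub_mul_rpow_neg_le {α x : ℝ} (hα : α ∈ Ioo (0 : ℝ) 1) (hx : 1 < x) :
    (1 - α) * x ^ (-α) ≤
      (x ^ (1 - α) - (x - 1) ^ (1 - α)) -
        ((x ^ (2 - α) - (x - 1) ^ (2 - α)) / (2 - α) - (x ^ (1 - α) + (x - 1) ^ (1 - α)) / 2) := by
  obtain ⟨h0, h1⟩ := hα
  have h2 : 2 - α ≠ 0 := by linarith
  set H : ℝ → ℝ := fun t => (t - x + 3 / 2) * t ^ (1 - α) - t ^ (2 - α) / (2 - α) -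
    (1 - α) * x ^ (-α) * ((t - x + 3 / 2) ^ 2 / 2) with hH
  have hd : ∀ t, 0 < t →
      HasDerivAt H ((t - x + 3 / 2) * ((1 - α) * (t ^ (-α) - x ^ (-α)))) t := by
    intro t ht
    have e : HasDerivAt (fun t : ℝ => t - x + 3 / 2) 1 t :=
      ((hasDerivAt_id t).sub_const x).add_const _
    have p := Real.hasDerivAt_rpow_const (p := 1 - α) (Or.inl ht.ne')
    have q := Real.hasDerivAt_rpow_const (p := 2 - α) (Or.inl ht.ne')
    rw [show 1 - α - 1 = -α by ring] at p
    rw [show 2 - α - 1 = 1 - α by ring] at q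
    refine HasDerivAt.congr_deriv (f := H) (((e.mul p).sub (q.div_const (2 - α))).sub
      (((e.pow 2).div_const 2).const_mul ((1 - α) * x ^ (-α)))) ?_
    rw [mul_div_cancel_left₀ _ h2]
    push_cast
    ring
  have hpos : ∀ t ∈ Icc (x - 1) x, 0 < t := fun t ht => by linarith [ht.1]
  have hmono : MonotoneOn H (Icc (x - 1) x) := by
    refine monotoneOn_of_hasDerivWithinAt_nonneg (convex_Icc _ _)
      (fun t ht => (hd t (hpos t ht)).continuousAt.continuousWithinAt)
      (fun t ht => (hd t (hpos t (interior_subset ht))).hasDerivWithinAt) fun t ht => ?_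
    have ht' := interior_subset ht
    have := Real.rpow_le_rpow_of_nonpos (hpos t ht') ht'.2 (by linarith : -α ≤ 0)
    exact mul_nonneg (by linarith [ht'.1]) (mul_nonneg (by linarith) (by linarith))
  have key := hmono (left_mem_Icc.2 (by linarith)) (right_mem_Icc.2 (by linarith))
    (by linarith : x - 1 ≤ x)
  simp only [hH] at key
  ring_nf at key ⊢
  linarith

/-- Lemma 5, inequality (19) of the paper:
if `α ∈ (0,1)`, `σ = 1 − α/2`, `τ > 0`, `j ≥ 1`, and `λ` is positive and nonincreasing
on `[0, (j+σ)τ]`, then `c_j^{(α)} > ((1−α)/2) λ_{j+σ} / (j+σ)^α`. -/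
theorem statement9 (α σ τ : ℝ) (hα : α ∈ Set.Ioo (0 : ℝ) 1) (hσ : σ = 1 - α / 2)
    (hτ : 0 < τ) (j : ℕ) (hj : 1 ≤ j) (lam : ℝ → ℝ)
    (hlam_pos : ∀ t ∈ Set.Icc (0 : ℝ) (((j : ℝ) + σ) * τ), 0 < lam t)
    (hlam_mono : AntitoneOn lam (Set.Icc (0 : ℝ) (((j : ℝ) + σ) * τ))) :
    cCoef α σ τ lam j j >
      ((1 - α) / 2) * lam (((j : ℝ) + σ) * τ) / (((j : ℝ) + σ) ^ α) := by
  obtain ⟨h0, h1⟩ := hα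
  have hj' : (1 : ℝ) ≤ j := by exact_mod_cast hj
  have hj0 : j ≠ 0 := by omega
  have hx : 1 < (j : ℝ) + σ := by linarith
  have hL := hlam_pos (((j : ℝ) + σ) * τ) ⟨by positivity, le_rfl⟩
  have hle : lam (((j : ℝ) + σ) * τ) ≤ lam (((j : ℝ) + σ - 1 / 2) * τ) :=
    hlam_mono ⟨mul_nonneg (by linarith) hτ.le, by gcongr; linarith⟩ ⟨by positivity, le_rfl⟩
      (by gcongr; linarith)
  have ha : 0 ≤ aCoef α σ j := by
    rw [aCoef, if_neg hj0, sub_nonneg]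
    exact Real.rpow_le_rpow (by linarith) (by linarith) (by linarith)
  have hab : (1 - α) * ((j : ℝ) + σ) ^ (-α) ≤ aCoef α σ j - bCoef α σ j := by
    have := one_sub_mul_rpow_neg_le ⟨h0, h1⟩ hx
    rw [aCoef, if_neg hj0, bCoef, show (j : ℝ) - 1 + σ = j + σ - 1 by ring]
    exact this
  have hp : 0 < (1 - α) * ((j : ℝ) + σ) ^ (-α) :=
    mul_pos (by linarith) (Real.rpow_pos_of_pos (by linarith) _)
  rw [cCoef, if_neg hj0, if_neg hj0, if_pos rfl, gt_iff_lt, div_eq_mul_inv,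
    ← Real.rpow_neg (by linarith)]
  nlinarith [mul_le_mul_of_nonneg_right hle ha, mul_le_mul_of_nonneg_left hab hL.le,
    mul_pos hL hp]
end

section
/- Let α ∈ (0,1), σ = 1 − α/2, τ > 0, j ≥ 1 an integer, and let λ : [0, (j+σ)τ] → ℝ be positive and nonincreasing. Then (2σ−1) c_0^{(α)} − σ c_1^{(α)} > 0, where c_0^{(α)} = λ_{σ−1/2} a_0^{(α)} + λ_σ b_1^{(α)} and c_1^{(α)} = λ_{1+σ−1/2} a_1^{(α)} + λ_{1+σ} b_2^{(α)} − λ_{1+σ} b_1^{(α)} (interpreting c_1^{(α)} = λ_{j+σ−1/2} a_j^{(α)} − λ_{j+σ} b_j^{(α)} when j = 1). -/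
/-- The trapezoidal rule on a unit interval overestimates the integral of a convex function. -/
theorem ConvexOn.sub_le_trapezoid {F f : ℝ → ℝ} {a : ℝ}
    (hf : ConvexOn ℝ (Set.Icc a (a + 1)) f)
    (hF : ∀ x ∈ Set.Icc a (a + 1), HasDerivAt F (f x) x) :
    F (a + 1) - F a ≤ (f (a + 1) + f a) / 2 := by
  have ha : a ∈ Set.Icc a (a + 1) := ⟨le_rfl, by linarith⟩
  have hb : a + 1 ∈ Set.Icc a (a + 1) := ⟨by linarith, le_rfl⟩
  have hG : ∀ x ∈ Set.Icc a (a + 1), HasDerivAt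
      (fun x ↦ F x - ((x - a) * f a + (x - a) ^ 2 * ((f (a + 1) - f a) / 2)))
      (f x - (f a + (x - a) * (f (a + 1) - f a))) x := by
    intro x hx
    have hx1 : HasDerivAt (fun x : ℝ ↦ x - a) 1 x := (hasDerivAt_id x).sub_const a
    refine ((hF x hx).sub ((hx1.mul_const (f a)).add
      ((hx1.pow 2).mul_const ((f (a + 1) - f a) / 2)))).congr_deriv ?_
    norm_num
    ring
  have hanti := antitoneOn_of_hasDerivWithinAt_nonpos (convex_Icc a (a + 1))
    (fun x hx ↦ (hG x hx).continuousAt.continuousWithinAt)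
    (fun x hx ↦ (hG x (interior_subset hx)).hasDerivWithinAt)
    (fun x hx ↦ by
      have hx' := interior_subset hx
      have h := hf.2 ha hb (sub_nonneg.2 hx'.2) (sub_nonneg.2 hx'.1) (by ring)
      simp only [smul_eq_mul] at h
      rw [show (a + 1 - x) * a + (x - a) * (a + 1) = x by ring] at h
      linarith)
  have h := hanti ha hb (by linarith)
  norm_num at h
  linarith

/-- The trapezoidal rule on a unit interval underestimates the integral of a concave function. -/
theorem ConcaveOn.trapezoid_le_sub {F f : ℝ → ℝ} {a : ℝ}
    (hf : ConcaveOn ℝ (Set.Icc a (a + 1)) f)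
    (hF : ∀ x ∈ Set.Icc a (a + 1), HasDerivAt F (f x) x) :
    (f (a + 1) + f a) / 2 ≤ F (a + 1) - F a := by
  have h := hf.neg.sub_le_trapezoid (F := -F) fun x hx ↦ (hF x hx).neg
  simp only [Pi.neg_apply] at h
  linarith

theorem convexOn_rpow_of_nonpos {r : ℝ} (hr : r ≤ 0) :
    ConvexOn ℝ (Set.Ioi 0) fun x : ℝ ↦ x ^ r := by
  have hd : ∀ x ∈ Set.Ioi (0 : ℝ), HasDerivAt (fun x : ℝ ↦ x ^ r) (r * x ^ (r - 1)) x :=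
    fun x hx ↦ Real.hasDerivAt_rpow_const (Or.inl (ne_of_gt hx))
  refine MonotoneOn.convexOn_of_deriv (convex_Ioi 0)
    (fun x hx ↦ (hd x hx).continuousAt.continuousWithinAt)
    (fun x hx ↦ (hd x (interior_subset hx)).differentiableAt.differentiableWithinAt) ?_
  rw [interior_Ioi]
  intro x hx y hy hxy
  rw [(hd x hx).deriv, (hd y hy).deriv]
  exact mul_le_mul_of_nonpos_left
    (Real.rpow_le_rpow_of_nonpos hx hxy (by linarith)) hr

/-- The error of the trapezoidal rule for `t ^ p` on `[x, x + 1]`. -/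
noncomputable def rpowTrapezoidError (p x : ℝ) : ℝ :=
  ((x + 1) ^ (p + 1) - x ^ (p + 1)) / (p + 1) - ((x + 1) ^ p + x ^ p) / 2

theorem rpowTrapezoidError_nonneg {p x : ℝ} (hp0 : 0 ≤ p) (hp1 : p ≤ 1) (hx : 0 < x) :
    0 ≤ rpowTrapezoidError p x := by
  have h := ((Real.concaveOn_rpow hp0 hp1).subset
    (fun y hy ↦ hx.le.trans hy.1) (convex_Icc x (x + 1))).trapezoid_le_sub
    (F := fun y ↦ y ^ (p + 1) / (p + 1)) fun y hy ↦ by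
      refine ((Real.hasDerivAt_rpow_const (p := p + 1)
        (Or.inl (hx.trans_le hy.1).ne')).div_const (p + 1)).congr_deriv ?_
      rw [add_sub_cancel_right]
      field_simp
  rw [rpowTrapezoidError, sub_div]
  linarith

theorem rpowTrapezoidError_antitoneOn {p : ℝ} (hp0 : 0 ≤ p) (hp1 : p ≤ 1) :
    AntitoneOn (rpowTrapezoidError p) (Set.Ioi 0) := by
  have hd : ∀ x ∈ Set.Ioi (0 : ℝ), HasDerivAt (rpowTrapezoidError p)
      ((x + 1) ^ p - x ^ p - p * ((x + 1) ^ (p - 1) + x ^ (p - 1)) / 2) x := by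
    intro x hx
    have hx0 : 0 < x := hx
    have hx1 : HasDerivAt (fun x : ℝ ↦ x + 1) 1 x := (hasDerivAt_id x).add_const 1
    have h1 (q : ℝ) := hx1.rpow_const (p := q) (Or.inl (by positivity))
    have h2 (q : ℝ) := Real.hasDerivAt_rpow_const (p := q) (Or.inl hx0.ne')
    refine ((((h1 (p + 1)).sub (h2 (p + 1))).div_const (p + 1)).sub
      (((h1 p).add (h2 p)).div_const 2)).congr_deriv ?_
    rw [add_sub_cancel_right]
    field_simp
  refine antitoneOn_of_hasDerivWithinAt_nonpos (convex_Ioi 0)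
    (fun x hx ↦ (hd x hx).continuousAt.continuousWithinAt)
    (fun x hx ↦ (hd x (interior_subset hx)).hasDerivWithinAt) ?_
  intro x hx
  have hx0 : 0 < x := interior_subset hx
  have h := (((convexOn_rpow_of_nonpos (r := p - 1) (by linarith)).smul hp0).subset
    (fun y hy ↦ hx0.trans_le hy.1) (convex_Icc x (x + 1))).sub_le_trapezoid
    (F := fun y ↦ y ^ p) fun y hy ↦
      Real.hasDerivAt_rpow_const (Or.inl (hx0.trans_le hy.1).ne')
  simp only [smul_eq_mul] at h
  linarith

theorem bCoef_eq_rpowTrapezoidError (α σ : ℝ) (l : ℕ) :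
    bCoef α σ l = rpowTrapezoidError (1 - α) (l - 1 + σ) := by
  rw [bCoef, rpowTrapezoidError, show (l : ℝ) - 1 + σ + 1 = l + σ by ring,
    show 1 - α + 1 = 2 - α by ring]

theorem mul_one_add_rpow_sub_rpow_lt {p σ : ℝ} (hp0 : 0 < p) (hp1 : p < 1) (hσ : 0 < σ) :
    σ * ((1 + σ) ^ p - σ ^ p) < p * σ ^ p := by
  have h := rpow_one_add_lt_one_add_mul_self (s := 1 / σ) (by linarith [one_div_pos.2 hσ])
    (one_div_pos.2 hσ).ne' hp0 hp1
  rw [show 1 + 1 / σ = (1 + σ) / σ by field_simp; ring, Real.div_rpow (by positivity) hσ.le,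
    div_lt_iff₀ (by positivity)] at h
  have h' := mul_lt_mul_of_pos_left h hσ
  have e : σ * ((1 + p * (1 / σ)) * σ ^ p) = (σ + p) * σ ^ p := by field_simp
  linarith

/-- Lemma 5, inequality (20) of the paper:
if `α ∈ (0,1)`, `σ = 1 − α/2`, `τ > 0`, `j ≥ 1`, and `λ` is positive and nonincreasing
on `[0, (j+σ)τ]`, then `(2σ−1) c_0^{(α)} − σ c_1^{(α)} > 0` (where `c_1` takes its
boundary form when `j = 1`). -/
theorem statement10 (α σ τ : ℝ) (hα : α ∈ Set.Ioo (0 : ℝ) 1) (hσ : σ = 1 - α / 2)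
    (hτ : 0 < τ) (j : ℕ) (hj : 1 ≤ j) (lam : ℝ → ℝ)
    (hlam_pos : ∀ t ∈ Set.Icc (0 : ℝ) (((j : ℝ) + σ) * τ), 0 < lam t)
    (hlam_mono : AntitoneOn lam (Set.Icc (0 : ℝ) (((j : ℝ) + σ) * τ))) :
    (2 * σ - 1) * cCoef α σ τ lam j 0 - σ * cCoef α σ τ lam j 1 > 0 := by
  obtain ⟨hα0, hα1⟩ := hα
  have hσ0 : 0 < σ := by linarith
  have hj' : (1 : ℝ) ≤ j := by exact_mod_cast hj
  have hmem : ∀ r, 0 ≤ r → r ≤ 1 + σ → r * τ ∈ Set.Icc (0 : ℝ) ((j + σ) * τ) := fun r h0 h1 ↦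
    ⟨by positivity, by gcongr; linarith⟩
  have hle : ∀ r s, 0 ≤ r → r ≤ s → s ≤ 1 + σ → lam (s * τ) ≤ lam (r * τ) := fun r s h0 h1 h2 ↦
    hlam_mono (hmem r h0 (h1.trans h2)) (hmem s (h0.trans h1) h2) (by gcongr)
  have h10 := hle (σ - 1 / 2) σ (by linarith) (by linarith) (by linarith)
  have h21 := hle σ (1 + σ - 1 / 2) (by linarith) (by linarith) (by linarith)
  have h32 := hle (1 + σ - 1 / 2) (1 + σ) (by linarith) (by linarith) (by linarith)
  have h3 := hlam_pos _ (hmem (1 + σ) (by linarith) le_rfl)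
  have ha0 : 0 < aCoef α σ 0 := by
    rw [aCoef, if_pos rfl]
    positivity
  have ha1 : σ * aCoef α σ 1 < (2 * σ - 1) * aCoef α σ 0 := by
    have h := mul_one_add_rpow_sub_rpow_lt (p := 1 - α) (by linarith) (by linarith) hσ0
    simp only [aCoef, if_pos, one_ne_zero, if_false, Nat.cast_one, sub_self, zero_add]
    rwa [show 2 * σ - 1 = 1 - α by linarith]
  have hb1 : 0 ≤ bCoef α σ 1 := by
    rw [bCoef_eq_rpowTrapezoidError]
    exact rpowTrapezoidError_nonneg (by linarith) (by linarith) (by simpa using hσ0)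
  have hb21 : bCoef α σ 2 ≤ bCoef α σ 1 := by
    rw [bCoef_eq_rpowTrapezoidError, bCoef_eq_rpowTrapezoidError]
    refine rpowTrapezoidError_antitoneOn (by linarith) (by linarith) ?_ ?_ ?_ <;>
      norm_num <;> linarith
  have hc0 : cCoef α σ τ lam j 0 =
      lam ((σ - 1 / 2) * τ) * aCoef α σ 0 + lam (σ * τ) * bCoef α σ 1 := by
    rw [cCoef, if_neg (by omega), if_pos rfl]
  have hc1 : cCoef α σ τ lam j 1 ≤ lam ((1 + σ - 1 / 2) * τ) * aCoef α σ 1 := by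
    rw [cCoef, if_neg (by omega), if_neg one_ne_zero]
    split_ifs with h
    · rw [← h, Nat.cast_one]
      linarith [mul_nonneg h3.le hb1]
    · rw [Nat.cast_one]
      linarith [mul_le_mul_of_nonneg_left hb21 h3.le]
  have h2 : 0 < lam ((1 + σ - 1 / 2) * τ) := h3.trans_le h32
  have hp : 0 ≤ 2 * σ - 1 := by linarith
  have key := mul_lt_mul_of_pos_left ha1 h2
  have hc1' := mul_le_mul_of_nonneg_left hc1 hσ0.le
  have hmono := mul_le_mul_of_nonneg_right (h21.trans h10) (mul_nonneg hp ha0.le)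
  have hb := mul_nonneg hp (mul_nonneg (h2.le.trans h21) hb1)
  rw [hc0]
  linarith
end

section
/- Let α ∈ (0,1), σ = 1 − α/2, τ > 0, j ≥ 1 an integer, and let λ : [0, (j+σ)τ] → ℝ be positive and nonincreasing. Then the coefficients c_s^{(α)} are strictly decreasing: c_0^{(α)} > c_1^{(α)} > c_2^{(α)} > … > c_{j−1}^{(α)} > c_j^{(α)}. -/
open Set

/-- The trapezoidal rule strictly overestimates the integral of a strictly convex function. -/
lemma StrictConvexOn.sub_lt_trapezoid {F f : ℝ → ℝ} {x : ℝ}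
    (hf : StrictConvexOn ℝ (Icc x (x + 1)) f)
    (hF : ∀ t ∈ Icc x (x + 1), HasDerivAt F (f t) t) :
    F (x + 1) - F x < (f x + f (x + 1)) / 2 := by
  set P : ℝ → ℝ := fun t => f x * (t - x) + (f (x + 1) - f x) * (t - x) ^ 2 / 2 with hP
  have hPd (t : ℝ) : HasDerivAt P (f x + (f (x + 1) - f x) * (t - x)) t := by
    have h1 : HasDerivAt (fun t : ℝ => t - x) 1 t := (hasDerivAt_id t).sub_const x
    refine ((h1.const_mul (f x)).add
      (((h1.pow 2).const_mul (f (x + 1) - f x)).div_const 2)).congr_deriv ?_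
    simp only [Nat.cast_ofNat, Nat.add_one_sub_one, pow_one]
    ring
  have hd : ∀ t ∈ Icc x (x + 1), HasDerivAt (fun t => F t - P t)
      (f t - (f x + (f (x + 1) - f x) * (t - x))) t := fun t ht => (hF t ht).sub (hPd t)
  have hanti : StrictAntiOn (fun t => F t - P t) (Icc x (x + 1)) := by
    refine strictAntiOn_of_hasDerivWithinAt_neg (convex_Icc _ _)
      (fun t ht => (hd t ht).continuousAt.continuousWithinAt)
      (fun t ht => (hd t (interior_subset ht)).hasDerivWithinAt) fun t ht => ?_
    rw [interior_Icc] at ht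
    have h := hf.2 (left_mem_Icc.2 (by linarith)) (right_mem_Icc.2 (by linarith))
      (lt_add_one x).ne
      (by linarith [ht.2] : 0 < 1 - (t - x)) (by linarith [ht.1] : 0 < t - x) (by ring)
    simp only [smul_eq_mul] at h
    rw [show (1 - (t - x)) * x + (t - x) * (x + 1) = t by ring] at h
    linarith
  have h := hanti (left_mem_Icc.2 (by linarith)) (right_mem_Icc.2 (by linarith))
    (lt_add_one x)
  simp only [hP] at h
  ring_nf at h ⊢
  linarith

/-- The trapezoidal rule strictly underestimates the integral of a strictly concave function. -/
lemma StrictConcaveOn.trapezoid_lt_sub {F f : ℝ → ℝ} {x : ℝ}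
    (hf : StrictConcaveOn ℝ (Icc x (x + 1)) f)
    (hF : ∀ t ∈ Icc x (x + 1), HasDerivAt F (f t) t) :
    (f x + f (x + 1)) / 2 < F (x + 1) - F x := by
  have h := hf.neg.sub_lt_trapezoid fun t ht => (hF t ht).neg
  simp only [Pi.neg_apply] at h
  linarith

lemma strictConvexOn_rpow_of_neg {p : ℝ} (hp : p < 0) :
    StrictConvexOn ℝ (Ioi 0) fun x : ℝ => x ^ p := by
  refine StrictMonoOn.strictConvexOn_of_deriv (convex_Ioi 0)
    (fun t ht => (Real.continuousAt_rpow_const t p (.inl (ne_of_gt ht))).continuousWithinAt) ?_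
  rw [interior_Ioi]
  intro x hx y hy hxy
  rw [Real.deriv_rpow_const, Real.deriv_rpow_const]
  exact mul_lt_mul_of_neg_left
    (Real.rpow_lt_rpow_of_neg hx hxy (by linarith)) hp

section Powers

variable {α x : ℝ}

lemma hasDerivAt_rpow_one_sub (hx : 0 < x) :
    HasDerivAt (fun t : ℝ => t ^ (1 - α)) ((1 - α) * x ^ (-α)) x := by
  refine (Real.hasDerivAt_rpow_const (.inl hx.ne')).congr_deriv ?_
  ring_nf

lemma hasDerivAt_rpow_two_sub_div (hα : α < 1) (hx : 0 < x) :
    HasDerivAt (fun t : ℝ => t ^ (2 - α) / (2 - α)) (x ^ (1 - α)) x := by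
  refine ((Real.hasDerivAt_rpow_const (.inl hx.ne')).div_const _).congr_deriv ?_
  rw [mul_div_cancel_left₀ _ (by linarith)]
  ring_nf

lemma rpow_one_sub_sub_lt (hα : α ∈ Ioo (0 : ℝ) 1) (hx : 0 < x) :
    (x + 1) ^ (1 - α) - x ^ (1 - α) < (1 - α) * (x ^ (-α) + (x + 1) ^ (-α)) / 2 := by
  have hsub : Icc x (x + 1) ⊆ Ioi 0 := fun t ht => hx.trans_le ht.1
  have h := ((strictConvexOn_rpow_of_neg (neg_lt_zero.2 hα.1)).subset hsub
    (convex_Icc _ _)).sub_lt_trapezoid (F := fun t => t ^ (1 - α) / (1 - α)) fun t ht =>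
      ((hasDerivAt_rpow_one_sub (hsub ht)).div_const (1 - α)).congr_deriv
        (mul_div_cancel_left₀ _ (by linarith [hα.2]))
  have h1 : 0 < 1 - α := by linarith [hα.2]
  simp only [← sub_div] at h
  rw [div_lt_iff₀ h1] at h
  linarith

lemma lt_rpow_one_sub_sub (hα : α ∈ Ioo (0 : ℝ) 1) (hx : 0 < x) :
    (1 - α) * (x + 1) ^ (-α) < (x + 1) ^ (1 - α) - x ^ (1 - α) := by
  obtain ⟨c, hc, h⟩ := exists_hasDerivAt_eq_slope (fun t : ℝ => t ^ (1 - α))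
    (fun t => (1 - α) * t ^ (-α)) (lt_add_one x)
    (fun t ht => (hasDerivAt_rpow_one_sub (hx.trans_le ht.1)).continuousAt.continuousWithinAt)
    (fun t ht => hasDerivAt_rpow_one_sub (hx.trans ht.1))
  simp only [add_sub_cancel_left, div_one] at h
  rw [← h]
  exact mul_lt_mul_of_pos_left
    (Real.rpow_lt_rpow_of_neg (hx.trans hc.1) hc.2 (neg_lt_zero.2 hα.1)) (by linarith [hα.2])

/-- The error of the trapezoidal rule for `t ↦ t ^ (1 - α)` on `[x, x + 1]`. -/
noncomputable def trapezoidDefect (α x : ℝ) : ℝ :=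
  (x + 1) ^ (2 - α) / (2 - α) - x ^ (2 - α) / (2 - α) - ((x + 1) ^ (1 - α) + x ^ (1 - α)) / 2

lemma trapezoidDefect_pos (hα : α ∈ Ioo (0 : ℝ) 1) (hx : 0 < x) : 0 < trapezoidDefect α x := by
  have hsub : Icc x (x + 1) ⊆ Ici 0 := fun t ht => hx.le.trans ht.1
  have h := ((Real.strictConcaveOn_rpow (p := 1 - α) (by linarith [hα.2])
    (by linarith [hα.1])).subset hsub (convex_Icc _ _)).trapezoid_lt_sub
      (F := fun t => t ^ (2 - α) / (2 - α)) fun t ht =>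
        hasDerivAt_rpow_two_sub_div hα.2 (hx.trans_le ht.1)
  simp only [trapezoidDefect]
  linarith

lemma hasDerivAt_trapezoidDefect (hα : α < 1) (hx : 0 < x) :
    HasDerivAt (trapezoidDefect α) ((x + 1) ^ (1 - α) - x ^ (1 - α) -
      ((1 - α) * (x + 1) ^ (-α) + (1 - α) * x ^ (-α)) / 2) x :=
  (((hasDerivAt_rpow_two_sub_div hα (by linarith)).comp_add_const x 1).sub
    (hasDerivAt_rpow_two_sub_div hα hx)).sub
    ((((hasDerivAt_rpow_one_sub (by linarith)).comp_add_const x 1).add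
      (hasDerivAt_rpow_one_sub hx)).div_const 2)

lemma trapezoidDefect_strictAntiOn (hα : α ∈ Ioo (0 : ℝ) 1) :
    StrictAntiOn (trapezoidDefect α) (Ioi 0) := by
  refine strictAntiOn_of_hasDerivWithinAt_neg (convex_Ioi 0)
    (fun t ht => (hasDerivAt_trapezoidDefect hα.2 ht).continuousAt.continuousWithinAt)
    (fun t ht => (hasDerivAt_trapezoidDefect hα.2 (interior_subset ht)).hasDerivWithinAt)
    fun t ht => ?_
  linarith [rpow_one_sub_sub_lt hα (interior_subset ht : t ∈ Ioi 0)]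

lemma increment_sub_trapezoidDefect_strictAntiOn (hα : α ∈ Ioo (0 : ℝ) 1) :
    StrictAntiOn (fun x => (x + 1) ^ (1 - α) - x ^ (1 - α) - trapezoidDefect α x) (Ioi 0) := by
  have hd : ∀ t ∈ Ioi (0 : ℝ), HasDerivAt
      (fun x => (x + 1) ^ (1 - α) - x ^ (1 - α) - trapezoidDefect α x) _ t := fun t ht =>
    (((hasDerivAt_rpow_one_sub (add_pos ht one_pos)).comp_add_const t 1).sub
      (hasDerivAt_rpow_one_sub ht)).sub (hasDerivAt_trapezoidDefect hα.2 ht)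
  refine strictAntiOn_of_hasDerivWithinAt_neg (convex_Ioi 0)
    (fun t ht => (hd t ht).continuousAt.continuousWithinAt)
    (fun t ht => (hd t (interior_subset ht)).hasDerivWithinAt) fun t ht => ?_
  have ht : 0 < t := interior_subset ht
  have h1 := lt_rpow_one_sub_sub hα ht
  have h2 := mul_lt_mul_of_pos_left (Real.rpow_lt_rpow_of_neg ht (lt_add_one t)
    (neg_lt_zero.2 hα.1)) (by linarith [hα.2] : 0 < 1 - α)
  linarith

end Powers

section Coefficients

variable {α σ : ℝ}

lemma aCoef_succ (α σ : ℝ) (l : ℕ) :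
    aCoef α σ (l + 1) = ((l : ℝ) + σ + 1) ^ (1 - α) - ((l : ℝ) + σ) ^ (1 - α) := by
  rw [aCoef, if_neg l.succ_ne_zero]
  push_cast
  ring_nf

lemma bCoef_succ (α σ : ℝ) (l : ℕ) :
    bCoef α σ (l + 1) = trapezoidDefect α ((l : ℝ) + σ) := by
  rw [bCoef, trapezoidDefect]
  push_cast
  ring_nf

lemma aCoef_succ_nonneg (hα : α ∈ Ioo (0 : ℝ) 1) (hσ : 0 < σ) (l : ℕ) :
    0 ≤ aCoef α σ (l + 1) := by
  rw [aCoef_succ, sub_nonneg]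
  exact Real.rpow_le_rpow (by positivity) (by linarith) (by linarith [hα.2])

lemma aCoef_one_lt_aCoef_zero (hα : α ∈ Ioo (0 : ℝ) 1) (hσ : 1 - α ≤ σ) :
    aCoef α σ 1 < aCoef α σ 0 := by
  have hα' : 0 < 1 - α := by linarith [hα.2]
  have hσ0 : 0 < σ := hα'.trans_le hσ
  have h0 : aCoef α σ 0 = σ * σ ^ (-α) := by
    rw [aCoef, if_pos rfl, sub_eq_add_neg, Real.rpow_add hσ0, Real.rpow_one]
  have h1 := aCoef_succ α σ 0
  simp only [zero_add, Nat.cast_zero] at h1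
  have h2 := rpow_one_sub_sub_lt hα hσ0
  have h3 := mul_lt_mul_of_pos_left (Real.rpow_lt_rpow_of_neg hσ0 (lt_add_one σ)
    (neg_lt_zero.2 hα.1)) hα'
  have h4 := mul_le_mul_of_nonneg_right hσ (Real.rpow_nonneg hσ0.le (-α))
  linarith

lemma bCoef_succ_pos (hα : α ∈ Ioo (0 : ℝ) 1) (hσ : 0 < σ) (l : ℕ) :
    0 < bCoef α σ (l + 1) := by
  rw [bCoef_succ]
  exact trapezoidDefect_pos hα (by positivity)

lemma bCoef_succ_succ_lt (hα : α ∈ Ioo (0 : ℝ) 1) (hσ : 0 < σ) (l : ℕ) :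
    bCoef α σ (l + 1 + 1) < bCoef α σ (l + 1) := by
  rw [bCoef_succ, bCoef_succ]
  exact trapezoidDefect_strictAntiOn hα (mem_Ioi.2 (by positivity)) (mem_Ioi.2 (by positivity))
    (by push_cast; linarith)

lemma aCoef_sub_bCoef_succ_succ_lt (hα : α ∈ Ioo (0 : ℝ) 1) (hσ : 0 < σ) (l : ℕ) :
    aCoef α σ (l + 1 + 1) - bCoef α σ (l + 1 + 1) < aCoef α σ (l + 1) - bCoef α σ (l + 1) := by
  simp only [bCoef_succ, aCoef_succ]
  exact increment_sub_trapezoidDefect_strictAntiOn hα (mem_Ioi.2 (by positivity))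
    (mem_Ioi.2 (by positivity)) (by push_cast; linarith)

end Coefficients

/-- Lemma 5, inequality (21) of the paper:
if `α ∈ (0,1)`, `σ = 1 − α/2`, `τ > 0`, `j ≥ 1`, and `λ` is positive and nonincreasing
on `[0, (j+σ)τ]`, then `c_0^{(α)} > c_1^{(α)} > … > c_{j−1}^{(α)} > c_j^{(α)}`. -/
theorem statement11 (α σ τ : ℝ) (hα : α ∈ Set.Ioo (0 : ℝ) 1) (hσ : σ = 1 - α / 2)
    (hτ : 0 < τ) (j : ℕ) (hj : 1 ≤ j) (lam : ℝ → ℝ)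
    (hlam_pos : ∀ t ∈ Set.Icc (0 : ℝ) (((j : ℝ) + σ) * τ), 0 < lam t)
    (hlam_mono : AntitoneOn lam (Set.Icc (0 : ℝ) (((j : ℝ) + σ) * τ))) :
    ∀ s, s < j → cCoef α σ τ lam j (s + 1) < cCoef α σ τ lam j s := by
  intro s hs
  have hσ_half : 1 / 2 < σ := by linarith [hα.2]
  have hσ0 : 0 < σ := by linarith
  have hs0 : (0 : ℝ) ≤ s := s.cast_nonneg
  have hsj : (s : ℝ) + 1 ≤ j := by exact_mod_cast hs
  have hmem (r : ℝ) (h0 : 0 ≤ r) (h1 : r ≤ j + σ) : r * τ ∈ Icc (0 : ℝ) ((j + σ) * τ) :=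
    ⟨by positivity, by gcongr⟩
  have hanti (r r' : ℝ) (h0 : 0 ≤ r) (hr : r ≤ r') (h1 : r' ≤ j + σ) :
      lam (r' * τ) ≤ lam (r * τ) :=
    hlam_mono (hmem r h0 (hr.trans h1)) (hmem r' (h0.trans hr) h1) (by gcongr)
  have hM := hanti (s + σ - 1 / 2) (s + σ) (by linarith) (by linarith) (by linarith)
  have hN := hanti (s + σ) (s + 1 + σ - 1 / 2) (by linarith) (by linarith) (by linarith)
  have hM0 := hlam_pos _ (hmem (s + σ) (by linarith) (by linarith))
  have hQ0 := hlam_pos _ (hmem (s + 1 + σ) (by linarith) (by linarith))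
  have hb := bCoef_succ_pos hα hσ0 s
  have hb' := bCoef_succ_succ_lt hα hσ0 s
  have ha := aCoef_succ_nonneg hα hσ0 s
  have hupper : cCoef α σ τ lam j (s + 1) ≤ lam ((s + σ) * τ) * aCoef α σ (s + 1) := by
    have h1 := mul_le_mul_of_nonneg_right hN ha
    rw [cCoef, if_neg (by lia), if_neg s.succ_ne_zero]
    split_ifs with h
    · have h2 := mul_pos hQ0 hb
      subst h
      push_cast
      linarith
    · have h2 := mul_lt_mul_of_pos_left hb' hQ0
      push_cast
      linarith
  refine hupper.trans_lt ?_
  rw [cCoef, if_neg (by lia)]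
  rcases s with _ | k
  · simp only [if_true, Nat.cast_zero, zero_add] at *
    have ha0 := aCoef_one_lt_aCoef_zero (σ := σ) hα (by linarith [hα.1])
    have h1 := mul_le_mul_of_nonneg_right hM (ha.trans ha0.le)
    have h2 := mul_lt_mul_of_pos_left ha0 hM0
    have h3 := mul_pos hM0 hb
    linarith
  · rw [if_neg k.succ_ne_zero, if_neg hs.ne]
    have h1 := mul_le_mul_of_nonneg_right hM (aCoef_succ_nonneg hα hσ0 k)
    have h2 := mul_lt_mul_of_pos_left (aCoef_sub_bCoef_succ_succ_lt hα hσ0 k) hM0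
    linarith
end

section
/- Let α ∈ (0,1), σ = 1 − α/2, T > 0. Let v : [0,T] → ℝ be three times continuously differentiable and let λ : [0,T] → ℝ be twice continuously differentiable with λ(t) > 0 and λ'(t) ≤ 0 on [0,T]. Then there exists a constant C > 0, depending only on α, T, v and λ, such that for every integer M ≥ 1, τ = T/M, and every integer j with 0 ≤ j ≤ M−1, one has | (1/Γ(1−α)) ∫_0^{t_{j+σ}} λ(t_{j+σ} − η) (t_{j+σ} − η)^{−α} v'(η) dη − (τ^{1−α}/Γ(2−α)) Σ_{s=0}^{j} c_{j−s}^{(α)} (v(t_{s+1}) − v(t_s))/τ | ≤ C τ², where t_s = sτ and t_{j+σ} = (j+σ)τ. -/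
open MeasureTheory Set

/-- On `S`, the function `f` and its first-order slope `f'` are bounded by `K`, `f` is `K`-Lipschitz,
and its first-order Taylor remainder is at most `K |y - x| ^ 2`. -/
structure IsTaylorBounded (S : Set ℝ) (f f' : ℝ → ℝ) (K : ℝ) : Prop where
  bound : ∀ x ∈ S, |f x| ≤ K
  slope_bound : ∀ x ∈ S, |f' x| ≤ K
  lipschitz : ∀ x ∈ S, ∀ y ∈ S, |f y - f x| ≤ K * |y - x|
  remainder : ∀ x ∈ S, ∀ y ∈ S, |f y - f x - f' x * (y - x)| ≤ K * |y - x| ^ 2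

namespace IsTaylorBounded

variable {S S' : Set ℝ} {f f' g g' : ℝ → ℝ} {K K' : ℝ}

theorem mono (h : IsTaylorBounded S f f' K) (hS : S' ⊆ S) (hK : K ≤ K') :
    IsTaylorBounded S' f f' K' where
  bound x hx := (h.bound x (hS hx)).trans hK
  slope_bound x hx := (h.slope_bound x (hS hx)).trans hK
  lipschitz x hx y hy := (h.lipschitz x (hS hx) y (hS hy)).trans (by gcongr)
  remainder x hx y hy := (h.remainder x (hS hx) y (hS hy)).trans (by gcongr)

theorem comp_sub_left {t T : ℝ} (h : IsTaylorBounded (Icc 0 T) f f' K) (ht : t ≤ T) :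
    IsTaylorBounded (Icc 0 t) (fun x ↦ f (t - x)) (fun x ↦ -f' (t - x)) K := by
  have hmem : ∀ x ∈ Icc 0 t, t - x ∈ Icc 0 T := fun x hx ↦
    ⟨by linarith [hx.2], by linarith [hx.1]⟩
  refine ⟨fun x hx ↦ h.bound _ (hmem x hx), fun x hx ↦ ?_, fun x hx y hy ↦ ?_,
    fun x hx y hy ↦ ?_⟩
  · rw [abs_neg]
    exact h.slope_bound _ (hmem x hx)
  · have := h.lipschitz _ (hmem x hx) _ (hmem y hy)
    rwa [show t - y - (t - x) = -(y - x) by ring, abs_neg] at this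
  · have := h.remainder _ (hmem x hx) _ (hmem y hy)
    rw [show t - y - (t - x) = -(y - x) by ring, abs_neg] at this
    rwa [neg_mul, ← mul_neg]

/-- Product rule for first-order Taylor remainders. -/
theorem remainder_mul (hf : IsTaylorBounded S f f' K) (hg : IsTaylorBounded S g g' K)
    {x y : ℝ} (hx : x ∈ S) (hy : y ∈ S) :
    |f y * g y - f x * g x - (f' x * g x + f x * g' x) * (y - x)| ≤ 3 * K ^ 2 * |y - x| ^ 2 := by
  have hK : 0 ≤ K := (abs_nonneg _).trans (hf.bound x hx)
  have e : f y * g y - f x * g x - (f' x * g x + f x * g' x) * (y - x) =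
      (f y - f x - f' x * (y - x)) * g y + f x * (g y - g x - g' x * (y - x)) +
        f' x * (g y - g x) * (y - x) := by ring
  rw [e]
  refine (abs_add_three _ _ _).trans ?_
  simp only [abs_mul]
  calc _ ≤ (K * |y - x| ^ 2) * K + K * (K * |y - x| ^ 2) + K * (K * |y - x|) * |y - x| := by
        gcongr
        exacts [hf.remainder x hx y hy, hg.bound y hy, hf.bound x hx, hg.remainder x hx y hy,
          hf.slope_bound x hx, hg.lipschitz x hx y hy]
    _ = _ := by ring

/-- Error of the constant approximation `f (m) d` of a product, corrected by its slope at `m`. -/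
theorem abs_mul_sub_le (hf : IsTaylorBounded S f f' K) (hg : IsTaylorBounded S g g' K)
    {m y τ d : ℝ} (hm : m ∈ S) (hy : y ∈ S) (hym : |y - m| ≤ τ / 2)
    (hd : |d - g m| ≤ K * τ ^ 2) :
    |f y * g y - (f m * d + (f' m * g m + f m * g' m) * (y - m))| ≤ 2 * K ^ 2 * τ ^ 2 := by
  have hK : 0 ≤ K := (abs_nonneg _).trans (hf.bound m hm)
  have e : f y * g y - (f m * d + (f' m * g m + f m * g' m) * (y - m)) =
      (f y * g y - f m * g m - (f' m * g m + f m * g' m) * (y - m)) - f m * (d - g m) := by ring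
  rw [e]
  refine (abs_sub _ _).trans ?_
  have h1 := hf.remainder_mul hg hm hy
  have h2 : |f m * (d - g m)| ≤ K * (K * τ ^ 2) := by
    rw [abs_mul]
    gcongr
    exact hf.bound m hm
  have h3 : 3 * K ^ 2 * |y - m| ^ 2 ≤ 3 * K ^ 2 * (τ / 2) ^ 2 := by gcongr
  nlinarith [mul_nonneg (sq_nonneg K) (sq_nonneg τ)]

/-- Error of the linear approximation of a product on `[x, x + τ]` whose slope is the difference
quotient of `f (x + τ) d₁` and `f x d₀`, where `d₀`, `d₁` approximate `g` at the midpoints of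
`[x, x + τ]` and `[x + τ, x + 2 τ]`. -/
theorem abs_mul_sub_linear_le (hf : IsTaylorBounded S f f' K) (hg : IsTaylorBounded S g g' K)
    {x y τ d₀ d₁ : ℝ} (hτ : 0 < τ) (hx : x ∈ S) (hm : x + τ / 2 ∈ S) (hxτ : x + τ ∈ S)
    (hm' : x + τ + τ / 2 ∈ S) (hy : y ∈ S) (hym : |y - (x + τ / 2)| ≤ τ / 2)
    (hd₀ : |d₀ - g (x + τ / 2)| ≤ K * τ ^ 2) (hd₁ : |d₁ - g (x + τ + τ / 2)| ≤ K * τ ^ 2) :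
    |f y * g y - (f (x + τ / 2) * d₀ +
      (f (x + τ) * d₁ - f x * d₀) / τ * (y - (x + τ / 2)))| ≤ 5 * K ^ 2 * τ ^ 2 := by
  have hK : 0 ≤ K := (abs_nonneg _).trans (hf.bound x hx)
  have hlip := hg.lipschitz _ hm _ hm'
  have hrem := hg.remainder _ hm _ hm'
  have hfx := hf.remainder _ hm _ hx
  have hfxτ := hf.remainder _ hm _ hxτ
  have hlf := hf.lipschitz _ hm _ hx
  rw [show x + τ + τ / 2 - (x + τ / 2) = τ by ring, abs_of_pos hτ] at hlip hrem
  rw [show x - (x + τ / 2) = -(τ / 2) by ring, abs_neg, abs_of_pos (half_pos hτ)] at hfx hlf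
  rw [show x + τ - (x + τ / 2) = τ / 2 by ring, abs_of_pos (half_pos hτ)] at hfxτ
  have hcst := hf.abs_mul_sub_le hg hm hy hym hd₀
  have hgm' := hg.bound _ hm'
  have hfm := hf.slope_bound _ hm
  have hgm := hg.slope_bound _ hm
  have hbx := hf.bound _ hx
  have hbxτ := hf.bound _ hxτ
  set m := x + τ / 2 with hm_def
  set m' := x + τ + τ / 2
  have hdiff : |f (x + τ) - f x - f' m * τ| ≤ K * τ ^ 2 / 2 := by
    have e : f (x + τ) - f x - f' m * τ =
        (f (x + τ) - f m - f' m * (τ / 2)) - (f x - f m - f' m * -(τ / 2)) := by ring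
    rw [e]
    refine (abs_sub _ _).trans ?_
    linarith
  have hslope : |f (x + τ) * d₁ - f x * d₀ - (f' m * g m + f m * g' m) * τ| ≤
      5 * K ^ 2 * τ ^ 2 := by
    have e : f (x + τ) * d₁ - f x * d₀ - (f' m * g m + f m * g' m) * τ =
        f (x + τ) * (d₁ - g m') - f x * (d₀ - g m) + ((f (x + τ) - f x - f' m * τ) * g m' +
          f' m * τ * (g m' - g m) + f x * (g m' - g m - g' m * τ) +
            (f x - f m) * g' m * τ) := by ring
    rw [e]
    have a1 : |f (x + τ) * (d₁ - g m')| ≤ K * (K * τ ^ 2) := by rw [abs_mul]; gcongr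
    have a2 : |f x * (d₀ - g m)| ≤ K * (K * τ ^ 2) := by rw [abs_mul]; gcongr
    have a3 : |(f (x + τ) - f x - f' m * τ) * g m'| ≤ K * τ ^ 2 / 2 * K := by
      rw [abs_mul]; gcongr
    have a4 : |f' m * τ * (g m' - g m)| ≤ K * τ * (K * τ) := by
      rw [abs_mul, abs_mul, abs_of_pos hτ]; gcongr
    have a5 : |f x * (g m' - g m - g' m * τ)| ≤ K * (K * τ ^ 2) := by rw [abs_mul]; gcongr
    have a6 : |(f x - f m) * g' m * τ| ≤ K * (τ / 2) * K * τ := by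
      rw [abs_mul, abs_mul, abs_of_pos hτ]; gcongr
    refine (abs_add_le _ _).trans ?_
    have b1 := abs_sub (f (x + τ) * (d₁ - g m')) (f x * (d₀ - g m))
    have b2 := abs_add_three ((f (x + τ) - f x - f' m * τ) * g m') (f' m * τ * (g m' - g m))
      (f x * (g m' - g m - g' m * τ))
    have b3 := abs_add_le ((f (x + τ) - f x - f' m * τ) * g m' + f' m * τ * (g m' - g m) +
      f x * (g m' - g m - g' m * τ)) ((f x - f m) * g' m * τ)
    linarith
  have e : f y * g y - (f m * d₀ + (f (x + τ) * d₁ - f x * d₀) / τ * (y - m)) =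
      (f y * g y - (f m * d₀ + (f' m * g m + f m * g' m) * (y - m))) -
        (f (x + τ) * d₁ - f x * d₀ - (f' m * g m + f m * g' m) * τ) * ((y - m) / τ) := by
    field_simp
    ring
  rw [e]
  refine (abs_sub _ _).trans ?_
  have hρ : |(y - m) / τ| ≤ 1 / 2 := by
    rw [abs_div, abs_of_pos hτ, div_le_iff₀ hτ]
    linarith
  have hprod : |(f (x + τ) * d₁ - f x * d₀ - (f' m * g m + f m * g' m) * τ) * ((y - m) / τ)| ≤
      5 * K ^ 2 * τ ^ 2 * (1 / 2) := by
    rw [abs_mul]; gcongr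
  nlinarith [mul_nonneg (sq_nonneg K) (sq_nonneg τ)]

end IsTaylorBounded

theorem abs_le_of_abs_hasDerivWithinAt_le {S : Set ℝ} (hS : Convex ℝ S) {φ φ' : ℝ → ℝ} {K x : ℝ}
    {n : ℕ} (hφ : ∀ z ∈ S, HasDerivWithinAt φ (φ' z) S z) (hx : x ∈ S) (hφx : φ x = 0)
    (hK : 0 ≤ K) (hb : ∀ z ∈ S, |φ' z| ≤ K * |z - x| ^ n) {y : ℝ} (hy : y ∈ S) :
    |φ y| ≤ K * |y - x| ^ (n + 1) := by
  have hsub : uIcc x y ⊆ S := by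
    rw [← segment_eq_uIcc]
    exact hS.segment_subset hx hy
  have h := (convex_uIcc x y).norm_image_sub_le_of_norm_hasDerivWithin_le
    (f := φ) (f' := φ') (C := K * |y - x| ^ n)
    (fun z hz ↦ (hφ z (hsub hz)).mono hsub) (fun z hz ↦ (hb z (hsub hz)).trans (by
      have : |z - x| ≤ |y - x| := abs_sub_left_of_mem_uIcc hz
      gcongr)) left_mem_uIcc right_mem_uIcc
  rw [hφx, sub_zero, Real.norm_eq_abs, Real.norm_eq_abs] at h
  rw [pow_succ, ← mul_assoc]
  exact h

theorem ContDiffOn.exists_isTaylorBounded {f : ℝ → ℝ} {T : ℝ} (hT : 0 < T)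
    (hf : ContDiffOn ℝ 2 f (Icc 0 T)) :
    ∃ K, IsTaylorBounded (Icc 0 T) f (derivWithin f (Icc 0 T)) K := by
  have hu := uniqueDiffOn_Icc hT
  rw [show (2 : WithTop ℕ∞) = 1 + 1 by norm_num, contDiffOn_succ_iff_derivWithin hu] at hf
  obtain ⟨hfd, -, hf1⟩ := hf
  set f' := derivWithin f (Icc 0 T)
  have hf1' := hf1
  rw [show (1 : WithTop ℕ∞) = 0 + 1 by norm_num, contDiffOn_succ_iff_derivWithin hu] at hf1'
  obtain ⟨hfd1, -, hf2⟩ := hf1'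
  obtain ⟨K0, h0⟩ := isCompact_Icc.exists_bound_of_continuousOn hfd.continuousOn
  obtain ⟨K1, h1⟩ := isCompact_Icc.exists_bound_of_continuousOn hf1.continuousOn
  obtain ⟨K2, h2⟩ := isCompact_Icc.exists_bound_of_continuousOn hf2.continuousOn
  have hlip : ∀ x ∈ Icc 0 T, ∀ y ∈ Icc 0 T, |f' y - f' x| ≤ K2 * |y - x| := fun x hx y hy ↦
    (convex_Icc 0 T).norm_image_sub_le_of_norm_hasDerivWithin_le
      (fun z hz ↦ (hfd1 z hz).hasDerivWithinAt) h2 hx hy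
  have hK2 : 0 ≤ K2 := (norm_nonneg _).trans (h2 0 (left_mem_Icc.2 hT.le))
  refine ⟨max K0 (max K1 K2), fun x hx ↦ (h0 x hx).trans (le_max_left _ _),
    fun x hx ↦ (h1 x hx).trans ((le_max_left _ _).trans (le_max_right _ _)),
    fun x hx y hy ↦ ?_, fun x hx y hy ↦ ?_⟩
  · refine ((convex_Icc 0 T).norm_image_sub_le_of_norm_hasDerivWithin_le
      (fun z hz ↦ (hfd z hz).hasDerivWithinAt) h1 hx hy).trans ?_
    rw [Real.norm_eq_abs]
    gcongr
    exact (le_max_left _ _).trans (le_max_right _ _)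
  · refine (abs_le_of_abs_hasDerivWithinAt_le (convex_Icc 0 T) (n := 1) (K := K2)
      (φ := fun y ↦ f y - f x - f' x * (y - x)) (φ' := fun y ↦ f' y - f' x)
      (fun z hz ↦ ?_) hx (by ring) hK2 (fun z hz ↦ by simpa using hlip x hx z hz) hy).trans ?_
    · have := ((hfd z hz).hasDerivWithinAt.sub_const (f x)).sub
        (((hasDerivWithinAt_id z (Icc 0 T)).sub_const x).const_mul (f' x))
      simp only [mul_one] at this
      exact this
    · gcongr
      exact (le_max_right _ _).trans (le_max_right _ _)

/-- Second-order accuracy of the central difference quotient. -/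
theorem IsTaylorBounded.abs_slope_sub_le {v w w' : ℝ → ℝ} {S : Set ℝ} {K x τ : ℝ}
    (hS : Convex ℝ S) (hv : ∀ z ∈ S, HasDerivWithinAt v (w z) S z)
    (hw : IsTaylorBounded S w w' K) (hτ : 0 < τ) (hx : x ∈ S) (hxτ : x + τ ∈ S) :
    |(v (x + τ) - v x) / τ - w (x + τ / 2)| ≤ K * τ ^ 2 := by
  have hm : x + τ / 2 ∈ S := hS.ordConnected.out hx hxτ ⟨by linarith, by linarith⟩
  have hK : 0 ≤ K := (abs_nonneg _).trans (hw.bound x hx)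
  set m := x + τ / 2 with hm_def
  have key : ∀ y ∈ S, |v y - v m - w m * (y - m) - w' m * ((y - m) ^ 2 / 2)| ≤
      K * |y - m| ^ (2 + 1) := fun y hy ↦ by
    refine abs_le_of_abs_hasDerivWithinAt_le hS (n := 2) (K := K)
      (φ := fun y ↦ v y - v m - w m * (y - m) - w' m * ((y - m) ^ 2 / 2))
      (φ' := fun y ↦ w y - w m - w' m * (y - m))
      (fun z hz ↦ ?_) hm (by ring) hK (fun z hz ↦ hw.remainder m hm z hz) hy
    have h := (((hv z hz).sub_const (v m)).sub
      (((hasDerivWithinAt_id z S).sub_const m).const_mul (w m))).sub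
      (((((hasDerivWithinAt_id z S).sub_const m).pow 2).div_const 2).const_mul (w' m))
    refine h.congr_deriv ?_
    simp
  have h1 := key _ hxτ
  have h2 := key _ hx
  rw [show x + τ - m = τ / 2 by rw [hm_def]; ring, abs_of_pos (half_pos hτ)] at h1
  rw [show x - m = -(τ / 2) by rw [hm_def]; ring, abs_neg, abs_of_pos (half_pos hτ)] at h2
  rw [div_sub' hτ.ne', abs_div, abs_of_pos hτ, div_le_iff₀ hτ,
    show v (x + τ) - v x - τ * w m =
      (v (x + τ) - v m - w m * (τ / 2) - w' m * ((τ / 2) ^ 2 / 2)) -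
        (v x - v m - w m * -(τ / 2) - w' m * ((-(τ / 2)) ^ 2 / 2)) by ring]
  refine (abs_sub _ _).trans ?_
  nlinarith [mul_nonneg hK (pow_pos hτ 3).le]

section Kernel

variable {α t : ℝ}

theorem intervalIntegrable_kernel (hα : α < 1) (a b : ℝ) :
    IntervalIntegrable (fun η ↦ (t - η) ^ (-α)) volume a b := by
  have h := (intervalIntegral.intervalIntegrable_rpow' (r := -α) (a := t - a) (b := t - b)
    (by linarith)).comp_sub_left t
  simpa using h

theorem integral_kernel (hα : α < 1) (p q : ℝ) :
    ∫ η in (t - p)..(t - q), (t - η) ^ (-α) = (p ^ (1 - α) - q ^ (1 - α)) / (1 - α) := by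
  rw [intervalIntegral.integral_comp_sub_left (fun u : ℝ ↦ u ^ (-α)) t,
    integral_rpow (Or.inl (by linarith))]
  simp [show -α + 1 = 1 - α by ring]

theorem integral_kernel_mul_sub (hα : α < 1) {p q : ℝ} (hp : 0 ≤ p) (hq : 0 ≤ q) (m : ℝ) :
    ∫ η in (t - p)..(t - q), (t - η) ^ (-α) * (η - m) =
      (t - m) * ((p ^ (1 - α) - q ^ (1 - α)) / (1 - α)) -
        (p ^ (2 - α) - q ^ (2 - α)) / (2 - α) := by
  have hint : ∀ r : ℝ, -1 < r → IntervalIntegrable (fun u : ℝ ↦ u ^ r) volume q p :=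
    fun r hr ↦ intervalIntegral.intervalIntegrable_rpow' hr
  have h1 : ∫ η in (t - p)..(t - q), (t - η) ^ (-α) * (η - m) =
      ∫ u in q..p, u ^ (-α) * (t - m - u) := by
    have := intervalIntegral.integral_comp_sub_left (a := t - p) (b := t - q)
      (fun u : ℝ ↦ u ^ (-α) * (t - m - u)) t
    simp only [sub_sub_cancel] at this
    rw [← this]
    congr 1
    ext η
    ring
  have h2 : ∫ u in q..p, u ^ (-α) * (t - m - u) =
      ∫ u in q..p, ((t - m) * u ^ (-α) - u ^ (1 - α)) := by
    refine intervalIntegral.integral_congr fun u hu ↦ ?_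
    have hu0 : 0 ≤ u := (le_inf hq hp).trans hu.1
    have : u ^ (1 - α) = u ^ (-α) * u := by
      rw [show 1 - α = -α + 1 by ring, Real.rpow_add_one' hu0 (by linarith)]
    simp only [this]
    ring
  rw [h1, h2, intervalIntegral.integral_sub ((hint _ (by linarith)).const_mul _)
    (hint _ (by linarith)), intervalIntegral.integral_const_mul,
    integral_rpow (Or.inl (by linarith)), integral_rpow (Or.inl (by linarith)),
    show -α + 1 = 1 - α by ring, show 1 - α + 1 = 2 - α by ring]

theorem abs_integral_kernel_mul_sub_le (hα : α < 1) {a b B : ℝ} {F P : ℝ → ℝ} (hab : a ≤ b)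
    (hbt : b ≤ t) (hF : ContinuousOn F (Icc a b)) (hP : ContinuousOn P (Icc a b))
    (hB : ∀ η ∈ Icc a b, |F η - P η| ≤ B) :
    |(∫ η in a..b, (t - η) ^ (-α) * F η) - ∫ η in a..b, (t - η) ^ (-α) * P η| ≤
      B * ∫ η in a..b, (t - η) ^ (-α) := by
  have hk := intervalIntegrable_kernel (t := t) hα a b
  rw [← uIcc_of_le hab] at hF hP
  rw [← intervalIntegral.integral_sub (hk.mul_continuousOn hF) (hk.mul_continuousOn hP),
    ← intervalIntegral.integral_const_mul]
  rw [← Real.norm_eq_abs]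
  refine intervalIntegral.norm_integral_le_of_norm_le hab
    (.of_forall fun η (hη : η ∈ Ioc a b) ↦ ?_) (hk.const_mul B)
  have h0 : 0 ≤ (t - η) ^ (-α) := Real.rpow_nonneg (by linarith [hη.2]) _
  rw [← mul_sub, norm_mul, Real.norm_of_nonneg h0, Real.norm_eq_abs, mul_comm]
  exact mul_le_mul_of_nonneg_right (hB η (Ioc_subset_Icc_self hη)) h0

/-- Integral of the kernel against a linear function over the `l`-th full cell before `t`. -/
theorem integral_kernel_mul_linear {σ τ : ℝ} (hα : α < 1) (hσ : 0 ≤ σ) (hτ : 0 < τ) {l : ℕ}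
    (hl : 1 ≤ l) (A D : ℝ) :
    ∫ η in (t - (l + σ) * τ)..(t - (l - 1 + σ) * τ),
        (t - η) ^ (-α) * (A + D / τ * (η - (t - (l + σ - 1 / 2) * τ))) =
      τ ^ (1 - α) / (1 - α) * (A * aCoef α σ l + D * bCoef α σ l) := by
  have hl' : (1 : ℝ) ≤ l := by exact_mod_cast hl
  set p : ℝ := l + σ with hp
  have hq : (l : ℝ) - 1 + σ = p - 1 := by rw [hp]; ring
  have hp1 : 0 ≤ p - 1 := by linarith
  have hp0 : 0 ≤ p := by linarith
  have hk := intervalIntegrable_kernel (t := t) hα (t - p * τ) (t - (p - 1) * τ)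
  have hsplit : ∀ η, (t - η) ^ (-α) * (A + D / τ * (η - (t - (p - 1 / 2) * τ))) =
      A * (t - η) ^ (-α) + D / τ * ((t - η) ^ (-α) * (η - (t - (p - 1 / 2) * τ))) :=
    fun η ↦ by ring
  have hpow : ∀ {r : ℝ}, 0 ≤ r → r ^ (2 - α) = r ^ (1 - α) * r := by
    intro r hr
    rw [show 2 - α = 1 - α + 1 by ring, Real.rpow_add_one' hr (by linarith)]
  rw [hq]
  simp only [hsplit]
  rw [intervalIntegral.integral_add (hk.const_mul _)
      ((hk.mul_continuousOn (by fun_prop)).const_mul _),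
    intervalIntegral.integral_const_mul, intervalIntegral.integral_const_mul,
    integral_kernel hα, integral_kernel_mul_sub hα (by positivity) (by positivity),
    Real.mul_rpow hp0 hτ.le, Real.mul_rpow hp0 hτ.le, Real.mul_rpow hp1 hτ.le,
    Real.mul_rpow hp1 hτ.le, aCoef, bCoef, if_neg (by omega), hq, ← hp,
    hpow hτ.le, hpow hp0, hpow hp1]
  have h1 : (1 : ℝ) - α ≠ 0 := by linarith
  have h2 : (2 : ℝ) - α ≠ 0 := by linarith
  field_simp
  ring

/-- On the last, incomplete cell the superconvergence point `σ = 1 - α / 2` annihilates the linear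
term. -/
theorem integral_kernel_mul_linear_last {σ τ : ℝ} (hα : α < 1) (hσ : σ = 1 - α / 2) (hτ : 0 < τ)
    (A D : ℝ) :
    ∫ η in (t - σ * τ)..t, (t - η) ^ (-α) * (A + D * (η - (t - (σ - 1 / 2) * τ))) =
      τ ^ (1 - α) / (1 - α) * (A * aCoef α σ 0) := by
  have hσ0 : 0 ≤ σ := by linarith
  have hk := intervalIntegrable_kernel (t := t) hα (t - σ * τ) (t - 0)
  have hsplit : ∀ η, (t - η) ^ (-α) * (A + D * (η - (t - (σ - 1 / 2) * τ))) =
      A * (t - η) ^ (-α) + D * ((t - η) ^ (-α) * (η - (t - (σ - 1 / 2) * τ))) :=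
    fun η ↦ by ring
  have hpow : ∀ {r : ℝ}, 0 ≤ r → r ^ (2 - α) = r ^ (1 - α) * r := by
    intro r hr
    rw [show 2 - α = 1 - α + 1 by ring, Real.rpow_add_one' hr (by linarith)]
  have h1 : (1 : ℝ) - α ≠ 0 := by linarith
  have h2 : (2 : ℝ) - α ≠ 0 := by linarith
  suffices h : ∫ η in (t - σ * τ)..(t - 0),
      (t - η) ^ (-α) * (A + D * (η - (t - (σ - 1 / 2) * τ))) =
        τ ^ (1 - α) / (1 - α) * (A * aCoef α σ 0) by rwa [sub_zero] at h
  simp only [hsplit]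
  rw [intervalIntegral.integral_add (hk.const_mul _)
      ((hk.mul_continuousOn (by fun_prop)).const_mul _),
    intervalIntegral.integral_const_mul, intervalIntegral.integral_const_mul,
    integral_kernel hα, integral_kernel_mul_sub hα (by positivity) le_rfl,
    Real.mul_rpow hσ0 hτ.le, Real.mul_rpow hσ0 hτ.le, aCoef, if_pos rfl, Real.zero_rpow h1,
    Real.zero_rpow h2, hpow hτ.le, hpow hσ0]
  have e : (t - (t - (σ - 1 / 2) * τ)) = (1 - α) / 2 * τ := by rw [hσ]; ring
  have e2 : σ = (2 - α) / 2 := by rw [hσ]; ring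
  rw [e]
  generalize hc : σ ^ (1 - α) = c
  rw [e2]
  field_simp
  ring

end Kernel

/-- Summation by parts: the coefficients `c` collect the contributions of the cells. -/
theorem sum_cCoef_mul (α σ τ : ℝ) (lam : ℝ → ℝ) (j : ℕ) (d : ℕ → ℝ) :
    ∑ s ∈ Finset.range (j + 1), cCoef α σ τ lam j (j - s) * d s =
      ∑ s ∈ Finset.range j,
        (lam ((((j - s : ℕ) : ℝ) + σ - 1 / 2) * τ) * d s * aCoef α σ (j - s) +
          (lam ((((j - s : ℕ) : ℝ) - 1 + σ) * τ) * d (s + 1) -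
            lam ((((j - s : ℕ) : ℝ) + σ) * τ) * d s) * bCoef α σ (j - s)) +
      lam ((σ - 1 / 2) * τ) * d j * aCoef α σ 0 := by
  have hc : ∀ k ≤ j, cCoef α σ τ lam j k = lam (((k : ℝ) + σ - 1 / 2) * τ) * aCoef α σ k +
      (if k = j then 0 else lam (((k : ℝ) + σ) * τ) * bCoef α σ (k + 1)) -
        (if k = 0 then 0 else lam (((k : ℝ) + σ) * τ) * bCoef α σ k) := by
    intro k hk
    unfold cCoef
    by_cases hj : j = 0
    · obtain rfl : k = 0 := by omega
      simp [hj]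
    · by_cases h0 : k = 0
      · simp [h0, hj, Ne.symm hj]
      · by_cases hkj : k = j
        · simp [hkj, hj]
        · simp [h0, hj, hkj]
  have h1 : ∀ s ∈ Finset.range (j + 1), cCoef α σ τ lam j (j - s) * d s =
      lam ((((j - s : ℕ) : ℝ) + σ - 1 / 2) * τ) * aCoef α σ (j - s) * d s +
      (if s = 0 then 0 else
        lam ((((j - s : ℕ) : ℝ) + σ) * τ) * bCoef α σ (j - s + 1) * d s) -
      (if s = j then 0 else lam ((((j - s : ℕ) : ℝ) + σ) * τ) * bCoef α σ (j - s) * d s) := by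
    intro s hs
    rw [Finset.mem_range] at hs
    rw [hc _ (Nat.sub_le _ _), if_congr (show j - s = j ↔ s = 0 ∨ j = 0 by omega) rfl rfl,
      if_congr (show j - s = 0 ↔ s = j by omega) rfl rfl]
    by_cases hs0 : s = 0
    · simp [hs0]; split_ifs <;> ring
    · have : j ≠ 0 := by omega
      by_cases hsj : s = j <;> simp [hs0, hsj, this] <;> ring
  rw [Finset.sum_congr rfl h1, Finset.sum_sub_distrib, Finset.sum_add_distrib,
    Finset.sum_range_succ (fun s ↦ lam ((((j - s : ℕ) : ℝ) + σ - 1 / 2) * τ) *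
      aCoef α σ (j - s) * d s), Finset.sum_range_succ', Finset.sum_range_succ (fun s ↦ if s = j
      then 0 else lam ((((j - s : ℕ) : ℝ) + σ) * τ) * bCoef α σ (j - s) * d s)]
  have h2 : ∑ s ∈ Finset.range j, (if s = j then 0 else
      lam ((((j - s : ℕ) : ℝ) + σ) * τ) * bCoef α σ (j - s) * d s) =
      ∑ s ∈ Finset.range j, lam ((((j - s : ℕ) : ℝ) + σ) * τ) * bCoef α σ (j - s) * d s :=
    Finset.sum_congr rfl fun s hs ↦ if_neg (Finset.mem_range.1 hs).ne
  have h3 : ∑ s ∈ Finset.range j, (if s + 1 = 0 then 0 else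
      lam ((((j - (s + 1) : ℕ) : ℝ) + σ) * τ) * bCoef α σ (j - (s + 1) + 1) * d (s + 1)) =
      ∑ s ∈ Finset.range j,
        lam ((((j - s : ℕ) : ℝ) - 1 + σ) * τ) * bCoef α σ (j - s) * d (s + 1) :=
    Finset.sum_congr rfl fun s hs ↦ by
      have hs := Finset.mem_range.1 hs
      rw [if_neg (Nat.succ_ne_zero s), show j - (s + 1) + 1 = j - s by omega,
        show ((j - (s + 1) : ℕ) : ℝ) = ((j - s : ℕ) : ℝ) - 1 by
          rw [← Nat.sub_sub, Nat.cast_sub (by omega), Nat.cast_one]]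
  rw [h2, h3]
  simp only [if_true, Nat.sub_self, Nat.cast_zero, zero_add, add_zero]
  rw [add_right_comm, add_sub_right_comm, ← Finset.sum_add_distrib, ← Finset.sum_sub_distrib,
    mul_right_comm]
  congr 1
  exact Finset.sum_congr rfl fun s _ ↦ by ring

/-- The discrete operator integrates the kernel exactly against a piecewise linear, second-order
accurate approximation of `lam (t - η) * w η`. -/
theorem abs_integral_sub_sum_cCoef_le {α σ τ t K : ℝ} {lam μ' w w' : ℝ → ℝ} {j : ℕ} {d : ℕ → ℝ}
    (hα0 : 0 ≤ α) (hα : α < 1) (hσ : σ = 1 - α / 2) (hτ : 0 < τ) (ht : t = (j + σ) * τ)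
    (hμ : IsTaylorBounded (Icc 0 t) (fun η ↦ lam (t - η)) μ' K)
    (hw : IsTaylorBounded (Icc 0 t) w w' K)
    (hμc : ContinuousOn (fun η ↦ lam (t - η)) (Icc 0 t)) (hwc : ContinuousOn w (Icc 0 t))
    (hd : ∀ s ≤ j, |d s - w (s * τ + τ / 2)| ≤ K * τ ^ 2) :
    |(∫ η in 0..t, (t - η) ^ (-α) * (lam (t - η) * w η)) -
      τ ^ (1 - α) / (1 - α) * ∑ s ∈ Finset.range (j + 1), cCoef α σ τ lam j (j - s) * d s| ≤
      5 * K ^ 2 * τ ^ 2 * ∫ η in 0..t, (t - η) ^ (-α) := by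
  have hσ1 : 1 / 2 < σ := by linarith
  have hσ2 : σ ≤ 1 := by linarith
  have hG : ContinuousOn (fun η ↦ lam (t - η) * w η) (Icc 0 t) := hμc.mul hwc
  have hnode : ∀ r : ℝ, 0 ≤ r → r ≤ j + σ → r * τ ∈ Icc 0 t := fun r h0 h1 ↦
    ⟨by positivity, by rw [ht]; gcongr⟩
  have hk : ∀ a b, IntervalIntegrable (fun η ↦ (t - η) ^ (-α)) volume a b :=
    intervalIntegrable_kernel hα
  have hkG : ∀ a ∈ Icc 0 t, ∀ b ∈ Icc 0 t,
      IntervalIntegrable (fun η ↦ (t - η) ^ (-α) * (lam (t - η) * w η)) volume a b :=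
    fun a ha b hb ↦ (hk a b).mul_continuousOn (hG.mono (ordConnected_Icc.uIcc_subset ha hb))
  have hcell : ∀ s ∈ Finset.range j,
      |(∫ η in (s * τ)..((s + 1 : ℕ) * τ), (t - η) ^ (-α) * (lam (t - η) * w η)) -
        τ ^ (1 - α) / (1 - α) *
          (lam ((((j - s : ℕ) : ℝ) + σ - 1 / 2) * τ) * d s * aCoef α σ (j - s) +
            (lam ((((j - s : ℕ) : ℝ) - 1 + σ) * τ) * d (s + 1) -
              lam ((((j - s : ℕ) : ℝ) + σ) * τ) * d s) * bCoef α σ (j - s))| ≤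
        5 * K ^ 2 * τ ^ 2 * ∫ η in (s * τ)..((s + 1 : ℕ) * τ), (t - η) ^ (-α) := by
    intro s hs
    have hsj := Finset.mem_range.1 hs
    have hs1 : (s : ℝ) + 1 ≤ j := by exact_mod_cast hsj
    have hs0 : (0 : ℝ) ≤ s := s.cast_nonneg
    rw [← integral_kernel_mul_linear (t := t) hα (by linarith) hτ (by omega),
      Nat.cast_sub hsj.le]
    have e0 : t - ((j : ℝ) - s + σ) * τ = s * τ := by rw [ht]; ring
    have e1 : t - ((j : ℝ) - s - 1 + σ) * τ = (s + 1 : ℕ) * τ := by rw [ht]; push_cast; ring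
    have em : t - ((j : ℝ) - s + σ - 1 / 2) * τ = s * τ + τ / 2 := by rw [ht]; ring
    rw [e0, e1, em]
    have h0 : (s : ℝ) * τ ∈ Icc 0 t := hnode _ hs0 (by linarith)
    have h1 : ((s + 1 : ℕ) : ℝ) * τ ∈ Icc 0 t := hnode _ (by positivity) (by push_cast; linarith)
    have hm : (s : ℝ) * τ + τ / 2 ∈ Icc 0 t := by
      rw [show (s : ℝ) * τ + τ / 2 = (s + 1 / 2) * τ by ring]
      exact hnode _ (by positivity) (by linarith)
    have hm' : (s : ℝ) * τ + τ + τ / 2 ∈ Icc 0 t := by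
      rw [show (s : ℝ) * τ + τ + τ / 2 = (s + 3 / 2) * τ by ring]
      exact hnode _ (by positivity) (by linarith)
    have e1' : ((s + 1 : ℕ) : ℝ) * τ = s * τ + τ := by push_cast; ring
    have hle : (s : ℝ) * τ ≤ (s + 1 : ℕ) * τ := by rw [e1']; linarith
    refine abs_integral_kernel_mul_sub_le hα hle h1.2
      (hG.mono (ordConnected_Icc.out h0 h1)) (by fun_prop) fun η hη ↦ ?_
    have hη' := ordConnected_Icc.out h0 h1 hη
    have hd1 := hd (s + 1) (by omega)
    rw [e1'] at h1 hη hd1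
    have := hμ.abs_mul_sub_linear_le hw hτ h0 hm h1 hm' hη'
      (abs_le.2 ⟨by linarith [hη.1], by linarith [hη.2]⟩) (hd s hsj.le) hd1
    rwa [← em, show t - (t - ((j : ℝ) - s + σ - 1 / 2) * τ) = ((j : ℝ) - s + σ - 1 / 2) * τ by
      ring, show t - (s * τ + τ) = ((j : ℝ) - s - 1 + σ) * τ by rw [ht]; ring,
      show t - s * τ = ((j : ℝ) - s + σ) * τ by rw [ht]; ring, em] at this
  have hlast : |(∫ η in (j * τ)..t, (t - η) ^ (-α) * (lam (t - η) * w η)) -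
      τ ^ (1 - α) / (1 - α) * (lam ((σ - 1 / 2) * τ) * d j * aCoef α σ 0)| ≤
        5 * K ^ 2 * τ ^ 2 * ∫ η in (j * τ)..t, (t - η) ^ (-α) := by
    have em : t - (σ - 1 / 2) * τ = j * τ + τ / 2 := by rw [ht]; ring
    have hjm : (j : ℝ) * τ + τ / 2 ∈ Icc 0 t := by
      rw [show (j : ℝ) * τ + τ / 2 = (j + 1 / 2) * τ by ring]
      exact hnode _ (by positivity) (by linarith)
    have hj : (j : ℝ) * τ ∈ Icc 0 t := hnode _ (by positivity) (by linarith)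
    have htt : t ∈ Icc 0 t := ⟨hj.1.trans hj.2, le_rfl⟩
    rw [← integral_kernel_mul_linear_last (t := t) hα hσ hτ _
      (μ' (j * τ + τ / 2) * w (j * τ + τ / 2) + lam (t - (j * τ + τ / 2)) * w' (j * τ + τ / 2)),
      em, show t - σ * τ = j * τ by rw [ht]; ring]
    refine abs_integral_kernel_mul_sub_le hα hj.2 le_rfl
      (hG.mono (ordConnected_Icc.out hj htt)) (by fun_prop) fun η hη ↦ ?_
    have hη2 : η ≤ j * τ + σ * τ := by rw [← add_mul, ← ht]; exact hη.2
    have hστ : σ * τ ≤ 1 * τ := by gcongr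
    have := hμ.abs_mul_sub_le hw hjm (ordConnected_Icc.out hj htt hη)
      (abs_le.2 ⟨by linarith [hη.1], by linarith⟩) (hd j le_rfl)
    rw [show (σ - 1 / 2) * τ = t - (j * τ + τ / 2) by rw [ht]; ring]
    exact this.trans (by gcongr; norm_num)
  have h0t : (0 : ℝ) ∈ Icc 0 t := by simpa using hnode 0 le_rfl (by positivity)
  have hjt : (j : ℝ) * τ ∈ Icc 0 t := hnode _ (by positivity) (by linarith)
  have htt : t ∈ Icc 0 t := ⟨h0t.2, le_rfl⟩
  have hsplitG := intervalIntegral.sum_integral_adjacent_intervals (μ := volume)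
    (a := fun s : ℕ ↦ (s : ℝ) * τ) (n := j)
    (f := fun η ↦ (t - η) ^ (-α) * (lam (t - η) * w η)) fun s hs ↦
      hkG _ (hnode _ (by positivity) (by
        have : (s : ℝ) ≤ j := by exact_mod_cast hs.le
        linarith)) _ (hnode _ (by positivity) (by
        have : ((s + 1 : ℕ) : ℝ) ≤ j := by exact_mod_cast hs
        linarith))
  have hsplitk := intervalIntegral.sum_integral_adjacent_intervals (μ := volume)
    (a := fun s : ℕ ↦ (s : ℝ) * τ) (n := j) (f := fun η ↦ (t - η) ^ (-α)) fun s _ ↦ hk _ _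
  simp only [Nat.cast_zero, zero_mul] at hsplitG hsplitk
  rw [sum_cCoef_mul, ← intervalIntegral.integral_add_adjacent_intervals (hkG 0 h0t _ hjt)
    (hkG _ hjt t htt), ← intervalIntegral.integral_add_adjacent_intervals (hk 0 (j * τ))
    (hk (j * τ) t), ← hsplitG, ← hsplitk, mul_add, mul_add, add_sub_add_comm, Finset.mul_sum,
    Finset.mul_sum, ← Finset.sum_sub_distrib]
  exact (abs_add_le _ _).trans (add_le_add
    ((Finset.abs_sum_le_sum_abs _ _).trans (Finset.sum_le_sum hcell)) hlast)

/-- Lemma 2 of the paper (second-order accuracy of the `_λ`L2-1`_σ` formula):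
if `α ∈ (0,1)`, `σ = 1 − α/2`, `v ∈ C³[0,T]`, `λ ∈ C²[0,T]` with `λ > 0` and `λ' ≤ 0`,
then there is `C > 0` such that for every `M ≥ 1`, `τ = T/M`, and every `0 ≤ j ≤ M−1`,
the generalized Caputo derivative of `v` at `t_{j+σ}` differs from the discrete
`_λ`L2-1`_σ` approximation by at most `C τ²`. -/
theorem statement13 (α σ T : ℝ) (hα : α ∈ Set.Ioo (0 : ℝ) 1) (hσ : σ = 1 - α / 2)
    (hT : 0 < T) (v lam : ℝ → ℝ)
    (hv : ContDiffOn ℝ 3 v (Set.Icc 0 T))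
    (hlam : ContDiffOn ℝ 2 lam (Set.Icc 0 T))
    (hlam_pos : ∀ t ∈ Set.Icc (0 : ℝ) T, 0 < lam t)
    (hlam_der : ∀ t ∈ Set.Icc (0 : ℝ) T, deriv lam t ≤ 0) :
    ∃ C > 0, ∀ M : ℕ, 1 ≤ M → ∀ j : ℕ, j < M →
      |(1 / Real.Gamma (1 - α)) *
          (∫ η in (0 : ℝ)..(((j : ℝ) + σ) * (T / M)),
            lam (((j : ℝ) + σ) * (T / M) - η) *
              (((j : ℝ) + σ) * (T / M) - η) ^ (-α) * deriv v η) -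
        ((T / M) ^ (1 - α) / Real.Gamma (2 - α)) *
          ∑ s ∈ Finset.range (j + 1),
            cCoef α σ (T / M) lam j (j - s) *
              ((v (((s : ℝ) + 1) * (T / M)) - v ((s : ℝ) * (T / M))) / (T / M))| ≤
      C * (T / M) ^ 2 := by
  obtain ⟨hα0, hα1⟩ := hα
  have hu := uniqueDiffOn_Icc hT
  rw [show (3 : WithTop ℕ∞) = 2 + 1 by norm_num, contDiffOn_succ_iff_derivWithin hu] at hv
  obtain ⟨hvd, -, hw⟩ := hv
  obtain ⟨K₁, hK₁⟩ := hw.exists_isTaylorBounded hT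
  obtain ⟨K₂, hK₂⟩ := hlam.exists_isTaylorBounded hT
  have hKv := hK₁.mono Subset.rfl (le_max_left K₁ (max K₂ 1))
  have hKl := hK₂.mono Subset.rfl ((le_max_left K₂ 1).trans (le_max_right K₁ _))
  have hK : 0 < max K₁ (max K₂ 1) :=
    one_pos.trans_le ((le_max_right K₂ 1).trans (le_max_right K₁ _))
  set K := max K₁ (max K₂ 1)
  set w := derivWithin v (Icc 0 T)
  have hΓ : 0 < Real.Gamma (1 - α) := Real.Gamma_pos_of_pos (by linarith)
  have h1α : 0 < 1 - α := by linarith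
  have hTα : 0 < T ^ (1 - α) := Real.rpow_pos_of_pos hT _
  refine ⟨1 / Real.Gamma (1 - α) * (5 * K ^ 2 * (T ^ (1 - α) / (1 - α))), by positivity,
    fun M hM j hj ↦ ?_⟩
  have hM0 : (0 : ℝ) < M := by exact_mod_cast hM
  have hτ : 0 < T / M := by positivity
  have hMτ : M * (T / M) = T := by field_simp
  set τ := T / M
  have hjM : (j : ℝ) + 1 ≤ M := by exact_mod_cast hj
  set t := ((j : ℝ) + σ) * τ with ht
  have ht0 : 0 ≤ t := mul_nonneg (add_nonneg j.cast_nonneg (by linarith)) hτ.le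
  have htT : t ≤ T := by
    rw [← hMτ]
    exact mul_le_mul_of_nonneg_right (by linarith) hτ.le
  have hsub : Icc 0 t ⊆ Icc 0 T := Icc_subset_Icc_right htT
  have hd : ∀ s ≤ j, |(v (((s : ℝ) + 1) * τ) - v (s * τ)) / τ - w (s * τ + τ / 2)| ≤
      K * τ ^ 2 := by
    intro s hs
    have hsj : (s : ℝ) ≤ j := by exact_mod_cast hs
    have hs0 : (0 : ℝ) ≤ s := s.cast_nonneg
    have e : ((s : ℝ) + 1) * τ = s * τ + τ := by ring
    have hsT : (s : ℝ) * τ + τ ≤ T := by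
      rw [← e, ← hMτ]
      gcongr
      linarith
    rw [e]
    exact hKv.abs_slope_sub_le (convex_Icc 0 T) (fun z hz ↦ (hvd z hz).hasDerivWithinAt) hτ
      ⟨by positivity, by linarith⟩ ⟨by positivity, hsT⟩
  have hmain := abs_integral_sub_sum_cCoef_le hα0.le hα1 hσ hτ ht (hKl.comp_sub_left htT)
    (hKv.mono hsub le_rfl)
    (hlam.continuousOn.comp (by fun_prop) fun x hx ↦
      ⟨by linarith [hx.2], by linarith [hx.1]⟩)
    (hw.continuousOn.mono hsub) hd
  have hint : ∫ η in 0..t, lam (t - η) * (t - η) ^ (-α) * deriv v η =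
      ∫ η in 0..t, (t - η) ^ (-α) * (lam (t - η) * w η) := by
    rw [intervalIntegral.integral_of_le ht0, intervalIntegral.integral_of_le ht0,
      integral_Ioc_eq_integral_Ioo, integral_Ioc_eq_integral_Ioo]
    refine setIntegral_congr_fun measurableSet_Ioo fun η hη ↦ ?_
    have : w η = deriv v η := derivWithin_of_mem_nhds
      (Icc_mem_nhds hη.1 (hη.2.trans_le htT))
    simp only [this]
    ring
  have hker : ∫ η in 0..t, (t - η) ^ (-α) ≤ T ^ (1 - α) / (1 - α) := by
    have h := integral_kernel (t := t) hα1 t 0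
    rw [sub_self, sub_zero, Real.zero_rpow h1α.ne', sub_zero] at h
    rw [h]
    gcongr
  have hΓ2 : Real.Gamma (2 - α) = (1 - α) * Real.Gamma (1 - α) := by
    rw [show 2 - α = 1 - α + 1 by ring, Real.Gamma_add_one h1α.ne']
  rw [hint, hΓ2, show τ ^ (1 - α) / ((1 - α) * Real.Gamma (1 - α)) =
    1 / Real.Gamma (1 - α) * (τ ^ (1 - α) / (1 - α)) by field_simp, mul_assoc, ← mul_sub, abs_mul,
    abs_of_pos (one_div_pos.2 hΓ), mul_assoc]
  refine mul_le_mul_of_nonneg_left (hmain.trans ?_) (one_div_pos.2 hΓ).le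
  calc _ ≤ 5 * K ^ 2 * τ ^ 2 * (T ^ (1 - α) / (1 - α)) := by gcongr
    _ = _ := by ring
end
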